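/- arXiv:gr-qc/0606011 — 10 statements merged into one kernel-verified Lean document; each statement's English description precedes it below -/
import Mathlib

section
/- If η₀ ≠ 0, then the Hubble parameter H(t) = ȧ(t)/a(t) exhibits a blow-up at the milestone: if η₀ > 0 then H(t) → +∞ as t → t⊙ from the right, and if η₀ < 0 then H(t) → −∞ as t → t⊙ from the right. -/
open Filter Topology

theorem tendsto_sub_nhdsGT_zero (t0 : ℝ) : Tendsto (fun t => t - t0) (𝓝[>] t0) (𝓝[>] 0) := by
  refine tendsto_nhdsWithin_iff.2 ⟨?_, ?_⟩
  · have h : Tendsto (fun t : ℝ => t - t0) (𝓝 t0) (𝓝 (t0 - t0)) :=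
      (continuous_id.sub continuous_const).tendsto t0
    rw [sub_self] at h
    exact h.mono_left nhdsWithin_le_nhds
  · filter_upwards [self_mem_nhdsWithin] with t ht
    exact sub_pos.2 (Set.mem_Ioi.1 ht)

theorem tendsto_rpow_neg_mul_sum_rpow (N : ℕ) (η b : ℕ → ℝ)
    (hη : ∀ i, 0 < i → i ≤ N → η 0 < η i) :
    Tendsto (fun x : ℝ => x ^ (-η 0) * ∑ i ∈ Finset.range (N + 1), b i * x ^ η i)
      (𝓝[>] 0) (𝓝 (b 0)) := by
  have hsum : Tendsto
      (fun x : ℝ => ∑ i ∈ Finset.range N, b (i + 1) * x ^ (η (i + 1) - η 0) + b 0)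
      (𝓝[>] 0) (𝓝 (∑ i ∈ Finset.range N, b (i + 1) * 0 + b 0)) := by
    refine (tendsto_finsetSum _ fun i hi => ?_).add_const _
    have hpos : 0 < η (i + 1) - η 0 :=
      sub_pos.2 (hη _ i.succ_pos (Finset.mem_range.1 hi))
    have h := (Real.continuousAt_rpow_const 0 _ (Or.inr hpos.le)).tendsto
    rw [Real.zero_rpow hpos.ne'] at h
    exact (h.mono_left nhdsWithin_le_nhds).const_mul _
  simp only [mul_zero, Finset.sum_const_zero, zero_add] at hsum
  refine hsum.congr' ?_
  filter_upwards [self_mem_nhdsWithin] with x hx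
  have hx : 0 < x := hx
  have hmul (i : ℕ) : x ^ (-η 0) * (b i * x ^ η i) = b i * x ^ (η i - η 0) := by
    rw [sub_eq_neg_add, Real.rpow_add hx]
    ring
  rw [Finset.mul_sum, Finset.sum_range_succ']
  simp only [hmul, sub_self, Real.rpow_zero, mul_one]

/-- Differentiating a generalized power series termwise: `(t - t₀) ȧ(t) = ∑ cᵢ ηᵢ (t - t₀) ^ ηᵢ`. -/
theorem sub_mul_deriv_eq_sum_rpow {t0 δ : ℝ} {N : ℕ} {η c : ℕ → ℝ} {a : ℝ → ℝ}
    (ha : ∀ t ∈ Set.Ioo t0 (t0 + δ),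
      a t = ∑ i ∈ Finset.range (N + 1), c i * (t - t0) ^ (η i))
    {t : ℝ} (ht : t ∈ Set.Ioo t0 (t0 + δ)) :
    (t - t0) * deriv a t = ∑ i ∈ Finset.range (N + 1), c i * η i * (t - t0) ^ (η i) := by
  have hpos : 0 < t - t0 := sub_pos.2 ht.1
  have hd : HasDerivAt (fun s => ∑ i ∈ Finset.range (N + 1), c i * (s - t0) ^ (η i))
      (∑ i ∈ Finset.range (N + 1), c i * (1 * η i * (t - t0) ^ (η i - 1))) t :=
    HasDerivAt.fun_sum fun i _ =>
      (((hasDerivAt_id t).sub_const t0).rpow_const (Or.inl hpos.ne')).const_mul (c i)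
  have heq : a =ᶠ[𝓝 t] fun s => ∑ i ∈ Finset.range (N + 1), c i * (s - t0) ^ (η i) :=
    Filter.eventually_of_mem (isOpen_Ioo.mem_nhds ht) ha
  rw [(hd.congr_of_eventuallyEq heq).deriv, Finset.mul_sum]
  refine Finset.sum_congr rfl fun i _ => ?_
  rw [Real.rpow_sub_one hpos.ne']
  field_simp

/-- For a generalized power-series scale factor with `η₀ ≠ 0` (bangs, crunches, rips),
the Hubble parameter `H = ȧ/a` blows up at the milestone: `H → +∞` if `η₀ > 0`
and `H → −∞` if `η₀ < 0`, as `t → t⊙⁺`. -/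
theorem hubble_blows_up_for_bangs_crunches_rips
    (t0 δ : ℝ) (N : ℕ) (η c : ℕ → ℝ) (a : ℝ → ℝ)
    (hδ : 0 < δ)
    (hηmono : ∀ i j : ℕ, i < j → j ≤ N → η i < η j)
    (hc0 : 0 < c 0)
    (hcne : ∀ i : ℕ, i ≤ N → c i ≠ 0)
    (ha : ∀ t ∈ Set.Ioo t0 (t0 + δ),
      a t = ∑ i ∈ Finset.range (N + 1), c i * (t - t0) ^ (η i)) :
    (0 < η 0 →
      Tendsto (fun t => deriv a t / a t) (𝓝[>] t0) atTop) ∧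
    (η 0 < 0 →
      Tendsto (fun t => deriv a t / a t) (𝓝[>] t0) atBot) := by
  have hη : ∀ i, 0 < i → i ≤ N → η 0 < η i := fun i => hηmono 0 i
  have hshift := tendsto_sub_nhdsGT_zero t0
  have hnum := (tendsto_rpow_neg_mul_sum_rpow N η (fun i => c i * η i) hη).comp hshift
  have hden := (tendsto_rpow_neg_mul_sum_rpow N η c hη).comp hshift
  have hlim := hnum.div hden hc0.ne'
  rw [mul_div_cancel_left₀ _ hc0.ne'] at hlim
  have hinv := tendsto_inv_nhdsGT_zero.comp hshift
  have heq : ∀ᶠ t in 𝓝[>] t0, (t - t0)⁻¹ *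
      (((t - t0) ^ (-η 0) * ∑ i ∈ Finset.range (N + 1), c i * η i * (t - t0) ^ (η i)) /
        ((t - t0) ^ (-η 0) * ∑ i ∈ Finset.range (N + 1), c i * (t - t0) ^ (η i))) =
      deriv a t / a t := by
    filter_upwards [Ioo_mem_nhdsGT (lt_add_of_pos_right t0 hδ)] with t ht
    have hpos : 0 < t - t0 := sub_pos.2 ht.1
    rw [← ha t ht, ← sub_mul_deriv_eq_sum_rpow ha ht,
      mul_div_mul_left _ _ (Real.rpow_pos_of_pos hpos _).ne', mul_div_assoc,
      inv_mul_cancel_left₀ hpos.ne']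
  exact ⟨fun h => (hinv.atTop_mul_pos h hlim).congr' heq,
    fun h => (hinv.atTop_mul_neg h hlim).congr' heq⟩
end

section
/- Suppose N ≥ 2. The deceleration parameter q(t) = −a(t)·ä(t)/ȧ(t)² has the following one-sided limit as t → t⊙ from the right: if η₀ ≠ 0 then q(t) → (1 − η₀)/η₀; if η₀ = 0 and η₁ ≠ 1 then q(t) → +∞ when c₁(1 − η₁) > 0 and q(t) → −∞ when c₁(1 − η₁) < 0; if η₀ = 0 and η₁ = 1 then: q(t) → 0 when η₂ > 2, q(t) → −2c₂c₀/c₁² when η₂ = 2, and q(t) → −∞ when c₂ > 0 and q(t) → +∞ when c₂ < 0 in the case 1 < η₂ < 2. In particular the limit of q is finite for all bangs, crunches and rips (η₀ ≠ 0), and is infinite only for a subset of the sudden singularities (η₀ = 0). -/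
open Filter Topology

/-- Termwise differentiation of a finite sum of real powers of `t - t0`. -/
theorem deriv_eq_sum_rpow {t0 δ : ℝ} {n : ℕ} {p b : ℕ → ℝ} {f : ℝ → ℝ}
    (hf : ∀ t ∈ Set.Ioo t0 (t0 + δ), f t = ∑ i ∈ Finset.range n, b i * (t - t0) ^ p i) :
    ∀ t ∈ Set.Ioo t0 (t0 + δ),
      deriv f t = ∑ i ∈ Finset.range n, b i * p i * (t - t0) ^ (p i - 1) := by
  intro t ht
  have hne : t - t0 ≠ 0 := (sub_pos.2 ht.1).ne'
  have hsum : HasDerivAt (fun s => ∑ i ∈ Finset.range n, b i * (s - t0) ^ p i)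
      (∑ i ∈ Finset.range n, b i * p i * (t - t0) ^ (p i - 1)) t := by
    refine HasDerivAt.fun_sum fun i _ => ?_
    have h := (((hasDerivAt_id' t).sub_const t0).rpow_const (p := p i) (Or.inl hne)).const_mul (b i)
    rwa [one_mul, ← mul_assoc] at h
  refine (hsum.congr_of_eventuallyEq ?_).deriv
  filter_upwards [isOpen_Ioo.mem_nhds ht] with s hs using hf s hs

/-- `(t - t0) ^ r → 0` as `t → t0` from the right, for `r > 0`. -/
theorem tendsto_sub_rpow_nhdsGT_zero (t0 : ℝ) {r : ℝ} (hr : 0 < r) :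
    Tendsto (fun t => (t - t0) ^ r) (𝓝[>] t0) (𝓝 0) := by
  have h : ContinuousAt (fun t => (t - t0) ^ r) t0 :=
    (continuousAt_id.sub continuousAt_const).rpow_const (Or.inr hr.le)
  have h' := h.tendsto
  simp only [sub_self, Real.zero_rpow hr.ne'] at h'
  exact h'.mono_left nhdsWithin_le_nhds

/-- `(t - t0) ^ r → ∞` as `t → t0` from the right, for `r < 0`. -/
theorem tendsto_sub_rpow_nhdsGT_atTop (t0 : ℝ) {r : ℝ} (hr : r < 0) :
    Tendsto (fun t => (t - t0) ^ r) (𝓝[>] t0) atTop := by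
  have hpos : ∀ᶠ t in 𝓝[>] t0, 0 < t - t0 := by
    filter_upwards [self_mem_nhdsWithin] with t ht using sub_pos.2 ht
  have h : Tendsto (fun t => (t - t0) ^ (-r)) (𝓝[>] t0) (𝓝[>] 0) :=
    tendsto_nhdsWithin_iff.2 ⟨tendsto_sub_rpow_nhdsGT_zero t0 (neg_pos.2 hr),
      hpos.mono fun t ht => Real.rpow_pos_of_pos ht _⟩
  refine h.inv_tendsto_nhdsGT_zero.congr' ?_
  filter_upwards [hpos] with t ht
  simp [Real.rpow_neg ht.le]

/-- The first term with a nonzero coefficient governs a finite sum of increasing real powers. -/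
theorem tendsto_sum_rpow_mul_rpow_neg {t0 δ : ℝ} (hδ : 0 < δ) {n k : ℕ} {p b : ℕ → ℝ}
    {f : ℝ → ℝ}
    (hf : ∀ t ∈ Set.Ioo t0 (t0 + δ), f t = ∑ i ∈ Finset.range n, b i * (t - t0) ^ p i)
    (hk : k < n) (hb : ∀ i < k, b i = 0) (hp : ∀ i, k < i → i < n → p k < p i) :
    Tendsto (fun t => f t * (t - t0) ^ (-p k)) (𝓝[>] t0) (𝓝 (b k)) := by
  have hsum : Tendsto (fun t => ∑ i ∈ Finset.range n, b i * (t - t0) ^ (p i - p k)) (𝓝[>] t0)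
      (𝓝 (∑ i ∈ Finset.range n, if i = k then b k else 0)) := by
    refine tendsto_finsetSum _ fun i hi => ?_
    rcases lt_trichotomy i k with h | rfl | h
    · simp [hb i h, h.ne]
    · simp
    · simpa [h.ne'] using (tendsto_sub_rpow_nhdsGT_zero t0
        (sub_pos.2 (hp i h (Finset.mem_range.1 hi)))).const_mul (b i)
  rw [Finset.sum_ite_eq' (Finset.range n) k, if_pos (Finset.mem_range.2 hk)] at hsum
  refine hsum.congr' ?_
  filter_upwards [Ioo_mem_nhdsGT (lt_add_of_pos_right t0 hδ)] with t ht
  rw [hf t ht, Finset.sum_mul]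
  refine Finset.sum_congr rfl fun i _ => ?_
  rw [mul_assoc, ← Real.rpow_add (sub_pos.2 ht.1), ← sub_eq_add_neg]

/-- Leading behaviour of the deceleration parameter: `k` and `m` are the indices of the leading
terms of the first and second derivatives of the scale factor. -/
theorem exists_deceleration_parameter_eq_mul_rpow
    {t0 δ : ℝ} {N k m : ℕ} {η c : ℕ → ℝ} {a : ℝ → ℝ} (hδ : 0 < δ)
    (hηmono : ∀ i j : ℕ, i < j → j ≤ N → η i < η j)
    (ha : ∀ t ∈ Set.Ioo t0 (t0 + δ),
      a t = ∑ i ∈ Finset.range (N + 1), c i * (t - t0) ^ (η i))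
    (hk : k ≤ N) (hm : m ≤ N) (hck : c k * η k ≠ 0)
    (hk0 : ∀ i < k, η i = 0) (hm0 : ∀ i < m, η i * (η i - 1) = 0) :
    ∃ g : ℝ → ℝ,
      Tendsto g (𝓝[>] t0) (𝓝 (-(c 0 * (c m * η m * (η m - 1))) / (c k * η k) ^ 2)) ∧
      (fun t => g t * (t - t0) ^ (η 0 + η m - 2 * η k)) =ᶠ[𝓝[>] t0]
        fun t => -(a t * deriv (deriv a) t) / (deriv a t) ^ 2 := by
  have ha' := deriv_eq_sum_rpow ha
  have ha'' := deriv_eq_sum_rpow ha'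
  have h0 := tendsto_sum_rpow_mul_rpow_neg (k := 0) hδ ha N.succ_pos (by simp)
    fun i hi hi' => hηmono 0 i hi (Nat.lt_succ_iff.1 hi')
  have h1 := tendsto_sum_rpow_mul_rpow_neg (k := k) hδ ha' (Nat.lt_succ_of_le hk)
    (fun i hi => by rw [hk0 i hi, mul_zero])
    fun i hi hi' => by linarith [hηmono k i hi (Nat.lt_succ_iff.1 hi')]
  have h2 := tendsto_sum_rpow_mul_rpow_neg (k := m) hδ ha'' (Nat.lt_succ_of_le hm)
    (fun i hi => by rw [mul_assoc, hm0 i hi, mul_zero])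
    fun i hi hi' => by linarith [hηmono m i hi (Nat.lt_succ_iff.1 hi')]
  refine ⟨_, (h0.mul h2).neg.div (h1.pow 2) (pow_ne_zero 2 hck), ?_⟩
  filter_upwards [self_mem_nhdsWithin] with t ht
  have hx : 0 < t - t0 := sub_pos.2 ht
  have hy : (t - t0) ^ (-(η k - 1)) ≠ 0 := (Real.rpow_pos_of_pos hx _).ne'
  have hpow : (t - t0) ^ (-η 0) * (t - t0) ^ (-(η m - 1 - 1)) *
      (t - t0) ^ (η 0 + η m - 2 * η k) = ((t - t0) ^ (-(η k - 1))) ^ 2 := by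
    rw [sq, ← Real.rpow_add hx, ← Real.rpow_add hx, ← Real.rpow_add hx]
    ring_nf
  simp only [Pi.div_apply]
  calc _ = -(a t * deriv (deriv a) t) * ((t - t0) ^ (-η 0) * (t - t0) ^ (-(η m - 1 - 1)) *
        (t - t0) ^ (η 0 + η m - 2 * η k)) /
        (deriv a t ^ 2 * ((t - t0) ^ (-(η k - 1))) ^ 2) := by ring
    _ = _ := by rw [hpow, mul_div_mul_right _ _ (pow_ne_zero 2 hy)]

/-- One-sided limit of the deceleration parameter `q = −a ä / ȧ²` at a generic
cosmological milestone described by a generalized power-series scale factor. -/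
theorem deceleration_parameter_limit
    (t0 δ : ℝ) (N : ℕ) (η c : ℕ → ℝ) (a : ℝ → ℝ)
    (hN : 2 ≤ N)
    (hδ : 0 < δ)
    (hηmono : ∀ i j : ℕ, i < j → j ≤ N → η i < η j)
    (hc0 : 0 < c 0)
    (hcne : ∀ i : ℕ, i ≤ N → c i ≠ 0)
    (ha : ∀ t ∈ Set.Ioo t0 (t0 + δ),
      a t = ∑ i ∈ Finset.range (N + 1), c i * (t - t0) ^ (η i)) :
    (η 0 ≠ 0 →
      Tendsto (fun t => -(a t * deriv (deriv a) t) / (deriv a t) ^ 2) (𝓝[>] t0)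
        (𝓝 ((1 - η 0) / η 0))) ∧
    (η 0 = 0 → η 1 ≠ 1 →
      (0 < c 1 * (1 - η 1) →
        Tendsto (fun t => -(a t * deriv (deriv a) t) / (deriv a t) ^ 2) (𝓝[>] t0) atTop) ∧
      (c 1 * (1 - η 1) < 0 →
        Tendsto (fun t => -(a t * deriv (deriv a) t) / (deriv a t) ^ 2) (𝓝[>] t0) atBot)) ∧
    (η 0 = 0 → η 1 = 1 →
      (2 < η 2 →
        Tendsto (fun t => -(a t * deriv (deriv a) t) / (deriv a t) ^ 2) (𝓝[>] t0) (𝓝 0)) ∧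
      (η 2 = 2 →
        Tendsto (fun t => -(a t * deriv (deriv a) t) / (deriv a t) ^ 2) (𝓝[>] t0)
          (𝓝 (-2 * c 2 * c 0 / (c 1) ^ 2))) ∧
      (1 < η 2 ∧ η 2 < 2 →
        (0 < c 2 →
          Tendsto (fun t => -(a t * deriv (deriv a) t) / (deriv a t) ^ 2) (𝓝[>] t0) atBot) ∧
        (c 2 < 0 →
          Tendsto (fun t => -(a t * deriv (deriv a) t) / (deriv a t) ^ 2) (𝓝[>] t0) atTop))) := by
  have h01 : η 0 < η 1 := hηmono 0 1 (by norm_num) (by omega)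
  have h12 : η 1 < η 2 := hηmono 1 2 (by norm_num) hN
  have hc1 : c 1 ≠ 0 := hcne 1 (by omega)
  refine ⟨fun hη0 => ?_, fun hη0 hη1 => ?_, fun hη0 hη1 => ?_⟩
  · obtain ⟨g, hg, hq⟩ := exists_deceleration_parameter_eq_mul_rpow (k := 0) (m := 0) hδ hηmono ha
      (by omega) (by omega) (mul_ne_zero hc0.ne' hη0) (by simp) (by simp)
    refine Tendsto.congr' hq ?_
    have he : η 0 + η 0 - 2 * η 0 = 0 := by ring
    simp only [he, Real.rpow_zero, mul_one]
    convert hg using 2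
    field_simp
    ring
  · have hη1pos : 0 < η 1 := hη0 ▸ h01
    obtain ⟨g, hg, hq⟩ := exists_deceleration_parameter_eq_mul_rpow (k := 1) (m := 1) hδ hηmono ha
      (by omega) (by omega) (mul_ne_zero hc1 hη1pos.ne')
      (by simpa using hη0) (by simp [hη0])
    have hx := tendsto_sub_rpow_nhdsGT_atTop t0
      (r := η 0 + η 1 - 2 * η 1) (by linarith)
    have hL : -(c 0 * (c 1 * η 1 * (η 1 - 1))) / (c 1 * η 1) ^ 2 =
        c 1 * (1 - η 1) * (c 0 * η 1 / (c 1 * η 1) ^ 2) := by ring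
    have hpos : 0 < c 0 * η 1 / (c 1 * η 1) ^ 2 := by positivity
    rw [hL] at hg
    exact ⟨fun h => (hg.pos_mul_atTop (mul_pos h hpos) hx).congr' hq,
      fun h => (hg.neg_mul_atTop (mul_neg_of_neg_of_pos h hpos) hx).congr' hq⟩
  · obtain ⟨g, hg, hq⟩ := exists_deceleration_parameter_eq_mul_rpow (k := 1) (m := 2) hδ hηmono ha
      (by omega) hN (mul_ne_zero hc1 (by simp [hη1])) (by simpa using hη0)
      (fun i hi => by interval_cases i <;> simp [hη0, hη1])
    have he : η 0 + η 2 - 2 * η 1 = η 2 - 2 := by rw [hη0, hη1]; ring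
    rw [he] at hq
    refine ⟨fun h2 => ?_, fun h2 => ?_, fun h2 => ?_⟩
    · simpa using (hg.mul (tendsto_sub_rpow_nhdsGT_zero t0 (sub_pos.2 h2))).congr' hq
    · refine Tendsto.congr' hq ?_
      simp only [h2, sub_self, Real.rpow_zero, mul_one]
      convert hg using 2
      rw [hη1, h2]
      ring
    · have hx := tendsto_sub_rpow_nhdsGT_atTop t0 (sub_neg.2 h2.2)
      have hL : -(c 0 * (c 2 * η 2 * (η 2 - 1))) / (c 1 * η 1) ^ 2 =
          -c 2 * (c 0 * η 2 * (η 2 - 1) / (c 1 * η 1) ^ 2) := by ring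
      have hpos : 0 < c 0 * η 2 * (η 2 - 1) / (c 1 * η 1) ^ 2 := by
        have hη2 : 0 < η 2 := by linarith
        have hη2' : 0 < η 2 - 1 := by linarith
        rw [hη1]
        positivity
      rw [hL] at hg
      exact ⟨fun h =>
          (hg.neg_mul_atTop (mul_neg_of_neg_of_pos (neg_neg_of_pos h) hpos) hx).congr' hq,
        fun h => (hg.pos_mul_atTop (mul_pos (neg_pos.2 h) hpos) hx).congr' hq⟩
end

section
/- (Polynomial curvature singularity theorem.) Suppose N ≥ 2 and k ∈ {−1, 0, 1}. Both −3 ä(t)/a(t) and 3(ȧ(t)²/a(t)² + k/a(t)²) converge to finite real limits as t → t⊙ from the right if and only if one of the following holds: (i) η₀ = 0 and η₁ ≥ 2; (ii) η₀ = 0, η₁ = 1 and η₂ ≥ 2; (iii) η₀ = 1, η₁ ≥ 3, k = −1 and c₀ = 1. Equivalently, the cosmological milestone at t⊙ fails to be a polynomial curvature singularity exactly in these three cases. -/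
open Filter Topology

/-- The generalized polynomial `∑ i < n, c i * (t - t₀) ^ e i` with real exponents. -/
noncomputable def genPoly (n : ℕ) (t0 : ℝ) (c e : ℕ → ℝ) (t : ℝ) : ℝ :=
  ∑ i ∈ Finset.range n, c i * (t - t0) ^ e i

theorem tendsto_sub_nhdsGT (t0 : ℝ) : Tendsto (fun t => t - t0) (𝓝[>] t0) (𝓝 0) := by
  have h : Continuous fun t : ℝ => t - t0 := by fun_prop
  simpa using (h.tendsto t0).mono_left nhdsWithin_le_nhds

theorem tendsto_sub_rpow_nhdsGT (t0 : ℝ) {p : ℝ} (hp : 0 < p) :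
    Tendsto (fun t => (t - t0) ^ p) (𝓝[>] t0) (𝓝 0) := by
  simpa [Real.zero_rpow hp.ne'] using (tendsto_sub_nhdsGT t0).rpow_const (Or.inr hp.le)

theorem genPoly_converges {n : ℕ} {t0 : ℝ} {c e : ℕ → ℝ}
    (h : ∀ i < n, c i = 0 ∨ 0 ≤ e i) :
    ∃ L, Tendsto (genPoly n t0 c e) (𝓝[>] t0) (𝓝 L) := by
  refine ⟨∑ i ∈ Finset.range n, c i * (0 : ℝ) ^ e i, tendsto_finsetSum _ fun i hi => ?_⟩
  rcases h i (Finset.mem_range.mp hi) with h | h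
  · simp [h]
  · exact ((tendsto_sub_nhdsGT t0).rpow_const (Or.inr h)).const_mul _

theorem tendsto_genPoly_of_exponent_eq_zero {n m : ℕ} {t0 : ℝ} {c e : ℕ → ℝ} (hm : m < n)
    (hem : e m = 0) (h : ∀ i < n, i ≠ m → c i = 0 ∨ 0 < e i) :
    Tendsto (genPoly n t0 c e) (𝓝[>] t0) (𝓝 (c m)) := by
  have hsum : ∑ i ∈ Finset.range n, (if i = m then c m else 0) = c m := by simp [hm]
  rw [← hsum]
  refine tendsto_finsetSum _ fun i hi => ?_
  split_ifs with him
  · simp [him, hem]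
  · rcases h i (Finset.mem_range.mp hi) him with h | h
    · simp [h]
    · simpa using (tendsto_sub_rpow_nhdsGT t0 h).const_mul (c i)

theorem rpow_mul_genPoly (n : ℕ) {t0 t : ℝ} (ht : t0 < t) (c e : ℕ → ℝ) (p : ℝ) :
    (t - t0) ^ p * genPoly n t0 c e t = genPoly n t0 c (fun i => e i + p) t := by
  simp only [genPoly, Finset.mul_sum]
  refine Finset.sum_congr rfl fun i _ => ?_
  rw [Real.rpow_add (sub_pos.mpr ht)]
  ring

/-- A convergent generalized polynomial has a nonnegative leading exponent. -/
theorem exponent_nonneg_of_tendsto_genPoly {n m : ℕ} {t0 L : ℝ} {c e : ℕ → ℝ} (hm : m < n)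
    (hcm : c m ≠ 0) (h : ∀ i < n, i ≠ m → c i = 0 ∨ e m < e i)
    (hL : Tendsto (genPoly n t0 c e) (𝓝[>] t0) (𝓝 L)) : 0 ≤ e m := by
  by_contra! hneg
  have hzero := (tendsto_sub_rpow_nhdsGT t0 (neg_pos.mpr hneg)).mul hL
  rw [zero_mul] at hzero
  have hlead : Tendsto (genPoly n t0 c fun i => e i + -e m) (𝓝[>] t0) (𝓝 (c m)) :=
    tendsto_genPoly_of_exponent_eq_zero hm (by ring) fun i hi him =>
      (h i hi him).imp_right fun h => by linarith
  refine hcm (tendsto_nhds_unique (hlead.congr' ?_) hzero)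
  filter_upwards [self_mem_nhdsWithin] with t ht
  exact (rpow_mul_genPoly n ht c e _).symm

theorem hasDerivAt_genPoly (n : ℕ) {t0 t : ℝ} (ht : t0 < t) (c e : ℕ → ℝ) :
    HasDerivAt (genPoly n t0 c e)
      (genPoly n t0 (fun i => c i * e i) (fun i => e i - 1) t) t := by
  unfold genPoly
  refine HasDerivAt.fun_sum fun i _ => ?_
  refine ((((hasDerivAt_id t).sub_const t0).rpow_const (p := e i)
    (Or.inl (sub_pos.mpr ht).ne')).const_mul (c i)).congr_deriv ?_
  simp only [id]
  ring

theorem deriv_eqOn_genPoly {n : ℕ} {t0 δ : ℝ} {c e : ℕ → ℝ} {f : ℝ → ℝ}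
    (h : Set.EqOn f (genPoly n t0 c e) (Set.Ioo t0 (t0 + δ))) :
    Set.EqOn (deriv f) (genPoly n t0 (fun i => c i * e i) (fun i => e i - 1))
      (Set.Ioo t0 (t0 + δ)) := fun _ ht =>
  ((h.eventuallyEq_of_mem (isOpen_Ioo.mem_nhds ht)).deriv_eq).trans
    (hasDerivAt_genPoly n ht.1 c e).deriv

/-- Polynomial curvature singularity theorem: for a generalized power-series scale
factor and `k ∈ {−1,0,1}`, both `R_t̂t̂ = −3ä/a` and `G_t̂t̂ = 3(ȧ²/a² + k/a²)` have
finite one-sided limits at the milestone (i.e. the milestone is *not* a polynomial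
curvature singularity) iff (i) `η₀ = 0, η₁ ≥ 2`, or (ii) `η₀ = 0, η₁ = 1, η₂ ≥ 2`,
or (iii) `η₀ = 1, η₁ ≥ 3, k = −1, c₀ = 1`. -/
theorem polynomial_curvature_singularity_iff
    (t0 δ k : ℝ) (N : ℕ) (η c : ℕ → ℝ) (a : ℝ → ℝ)
    (hN : 2 ≤ N)
    (hδ : 0 < δ)
    (hk : k = -1 ∨ k = 0 ∨ k = 1)
    (hηmono : ∀ i j : ℕ, i < j → j ≤ N → η i < η j)
    (hc0 : 0 < c 0)
    (hcne : ∀ i : ℕ, i ≤ N → c i ≠ 0)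
    (ha : ∀ t ∈ Set.Ioo t0 (t0 + δ),
      a t = ∑ i ∈ Finset.range (N + 1), c i * (t - t0) ^ (η i)) :
    ((∃ L : ℝ, Tendsto (fun t => -3 * deriv (deriv a) t / a t) (𝓝[>] t0) (𝓝 L)) ∧
     (∃ L : ℝ, Tendsto (fun t => 3 * ((deriv a t) ^ 2 / (a t) ^ 2 + k / (a t) ^ 2))
        (𝓝[>] t0) (𝓝 L))) ↔
    ((η 0 = 0 ∧ 2 ≤ η 1) ∨
     (η 0 = 0 ∧ η 1 = 1 ∧ 2 ≤ η 2) ∨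
     (η 0 = 1 ∧ 3 ≤ η 1 ∧ k = -1 ∧ c 0 = 1)) := by
  have hEq : Set.EqOn a (genPoly (N + 1) t0 c η) (Set.Ioo t0 (t0 + δ)) := ha
  have hEq1 := deriv_eqOn_genPoly hEq
  have hEq2 := deriv_eqOn_genPoly hEq1
  have hIoo : Set.Ioo t0 (t0 + δ) ∈ 𝓝[>] t0 := Ioo_mem_nhdsGT (by linarith)
  set d : ℕ → ℝ := fun i => c i * η i * (η i - 1) with hd
  set u := genPoly (N + 1) t0 c (fun i => η i + -η 0) with hu
  set v := genPoly (N + 1) t0 d (fun i => η i - 1 - 1 + -η 0) with hv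
  have hη0 : ∀ i < N + 1, i ≠ 0 → η 0 < η i := fun i hi h0 =>
    hηmono 0 i (Nat.pos_of_ne_zero h0) (by omega)
  have hη1 : ∀ i < N + 1, i ≠ 0 → η 1 ≤ η i := fun i hi h0 => by
    rcases (show i = 1 ∨ 1 < i by omega) with rfl | h1
    · rfl
    · exact (hηmono 1 i h1 (by omega)).le
  have hu_lim : Tendsto u (𝓝[>] t0) (𝓝 (c 0)) :=
    tendsto_genPoly_of_exponent_eq_zero (by omega) (by ring) fun i hi h0 =>
      Or.inr (by linarith [hη0 i hi h0])
  have hu_ne : ∀ᶠ t in 𝓝[>] t0, u t ≠ 0 := hu_lim.eventually_ne hc0.ne'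
  have ha_u : ∀ t ∈ Set.Ioo t0 (t0 + δ), a t = (t - t0) ^ η 0 * u t := fun t ht => by
    rw [hEq ht, hu, rpow_mul_genPoly _ ht.1]
    simp
  have hR_eq : ∀ᶠ t in 𝓝[>] t0, -3 * deriv (deriv a) t / a t = -3 * (v t / u t) := by
    filter_upwards [hIoo] with t ht
    have hpos := Real.rpow_pos_of_pos (sub_pos.mpr ht.1) (η 0)
    have hnum : deriv (deriv a) t = (t - t0) ^ η 0 * v t := by
      rw [hEq2 ht, hv, rpow_mul_genPoly _ ht.1]
      simp [hd]
    rw [hnum, ha_u t ht, mul_left_comm, mul_div_mul_left _ _ hpos.ne', mul_div_assoc]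
  have hR : (∃ L : ℝ, Tendsto (fun t => -3 * deriv (deriv a) t / a t) (𝓝[>] t0) (𝓝 L)) ↔
      ∃ L : ℝ, Tendsto v (𝓝[>] t0) (𝓝 L) := by
    constructor
    · rintro ⟨L, hL⟩
      refine ⟨_, ((hL.mul hu_lim).const_mul (-1 / 3)).congr' ?_⟩
      filter_upwards [hR_eq, hu_ne] with t ht hut
      rw [ht]
      field_simp
    · rintro ⟨L, hL⟩
      exact ⟨_, ((hL.div hu_lim hc0.ne').const_mul (-3)).congr' (hR_eq.mono fun t ht => ht.symm)⟩
  rw [hR]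
  constructor
  · rintro ⟨⟨Lv, hLv⟩, ⟨LG, hLG⟩⟩
    have h0 : η 0 = 0 ∨ η 0 = 1 := by
      by_contra! hne
      have := exponent_nonneg_of_tendsto_genPoly (m := 0) (by omega)
        (mul_ne_zero (mul_ne_zero hc0.ne' hne.1) (sub_ne_zero.mpr hne.2))
        (fun i hi hi0 => Or.inr (by linarith [hη0 i hi hi0])) hLv
      linarith
    have h01 := hη0 1 (by omega) one_ne_zero
    have hd0 : d 0 = 0 := by rcases h0 with h | h <;> simp [hd, h]
    have hlead1 : η 1 ≠ 1 → 2 ≤ η 1 - η 0 := fun hne => by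
      have := exponent_nonneg_of_tendsto_genPoly (m := 1) (by omega)
        (mul_ne_zero (mul_ne_zero (hcne 1 (by omega)) (by rcases h0 with h | h <;> linarith))
          (sub_ne_zero.mpr hne))
        (fun i hi hi1 => by
          rcases Nat.eq_zero_or_pos i with rfl | hi0
          · exact Or.inl hd0
          · exact Or.inr (by linarith [hηmono 1 i (by omega) (by omega)])) hLv
      linarith
    rcases h0 with h0 | h0
    · by_cases h1 : η 1 = 1
      · right; left
        have h12 := hηmono 1 2 (by omega) hN
        have := exponent_nonneg_of_tendsto_genPoly (m := 2) (by omega)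
          (mul_ne_zero (mul_ne_zero (hcne 2 hN) (by linarith))
            (sub_ne_zero.mpr (by linarith)))
          (fun i hi hi2 => by
            rcases (show i = 0 ∨ i = 1 ∨ 2 < i by omega) with rfl | rfl | hi2
            · exact Or.inl hd0
            · exact Or.inl (by simp [hd, h1])
            · exact Or.inr (by linarith [hηmono 2 i hi2 (by omega)])) hLv
        exact ⟨h0, h1, by linarith⟩
      · exact Or.inl ⟨h0, by linarith [hlead1 h1]⟩
    · right; right
      have ha'_lim : Tendsto (deriv a) (𝓝[>] t0) (𝓝 (c 0 * η 0)) :=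
        (tendsto_genPoly_of_exponent_eq_zero (c := fun i => c i * η i) (by omega) (by simp [h0])
          fun i hi hi0 => Or.inr (by linarith [hη0 i hi hi0])).congr'
          (hEq1.symm.eventuallyEq_of_mem hIoo)
      have ha_lim : Tendsto a (𝓝[>] t0) (𝓝 (0 * c 0)) :=
        ((tendsto_sub_rpow_nhdsGT t0 (by linarith : 0 < η 0)).mul hu_lim).congr'
          (by filter_upwards [hIoo] with t ht using (ha_u t ht).symm)
      have hzero := ((hLG.mul (ha_lim.pow 2)).const_mul (1 / 3)).congr'
        (f₂ := fun t => deriv a t ^ 2 + k) (by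
          filter_upwards [hIoo, hu_ne] with t ht hut
          have hne : a t ≠ 0 := by
            rw [ha_u t ht]
            exact mul_ne_zero (Real.rpow_pos_of_pos (sub_pos.mpr ht.1) _).ne' hut
          field_simp)
      have hck : c 0 ^ 2 + k = 0 := by
        simpa [h0] using tendsto_nhds_unique ((ha'_lim.pow 2).add_const k) hzero
      have hk' : k = -1 := by
        rcases hk with h | h | h
        · exact h
        all_goals nlinarith [sq_pos_of_pos hc0]
      exact ⟨h0, by linarith [hlead1 (by linarith)], hk', by nlinarith⟩
  · have hG_of_zero : η 0 = 0 → 1 ≤ η 1 →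
        ∃ L : ℝ, Tendsto (fun t => 3 * ((deriv a t) ^ 2 / (a t) ^ 2 + k / (a t) ^ 2))
          (𝓝[>] t0) (𝓝 L) := fun h0 h1 => by
      have ha_lim : Tendsto a (𝓝[>] t0) (𝓝 (c 0)) := hu_lim.congr' (by
        filter_upwards [hIoo] with t ht
        simp [ha_u t ht, h0])
      obtain ⟨L, hL⟩ := genPoly_converges (n := N + 1) (t0 := t0) (c := fun i => c i * η i)
        (e := fun i => η i - 1) fun i hi => by
          rcases Nat.eq_zero_or_pos i with rfl | hi0
          · simp [h0]
          · exact Or.inr (by linarith [hη1 i hi hi0.ne'])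
      have ha'_lim := hL.congr' (hEq1.symm.eventuallyEq_of_mem hIoo)
      have hne : c 0 ^ 2 ≠ 0 := pow_ne_zero 2 hc0.ne'
      exact ⟨_, (((ha'_lim.pow 2).div (ha_lim.pow 2) hne).add
        (tendsto_const_nhds.div (ha_lim.pow 2) hne)).const_mul 3⟩
    rintro (⟨h0, h1⟩ | ⟨h0, h1, h2⟩ | ⟨h0, h1, rfl, hc⟩)
    · refine ⟨genPoly_converges fun i hi => ?_, hG_of_zero h0 (by linarith)⟩
      rcases Nat.eq_zero_or_pos i with rfl | hi0
      · simp [hd, h0]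
      · exact Or.inr (by linarith [hη1 i hi hi0.ne'])
    · refine ⟨genPoly_converges fun i hi => ?_, hG_of_zero h0 h1.ge⟩
      rcases (show i = 0 ∨ i = 1 ∨ i = 2 ∨ 2 < i by omega) with rfl | rfl | rfl | hi2
      · simp [hd, h0]
      · simp [hd, h1]
      · exact Or.inr (by linarith)
      · exact Or.inr (by linarith [hηmono 2 i hi2 (by omega)])
    · refine ⟨genPoly_converges fun i hi => ?_, ?_⟩
      · rcases Nat.eq_zero_or_pos i with rfl | hi0
        · simp [hd, h0]
        · exact Or.inr (by linarith [hη1 i hi hi0.ne'])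
      set r := genPoly N t0 (fun i => c (i + 1) * η (i + 1)) (fun i => η (i + 1) - 1 + -2) with hr
      obtain ⟨L, hL⟩ : ∃ L, Tendsto r (𝓝[>] t0) (𝓝 L) := genPoly_converges fun i hi =>
        Or.inr (by linarith [hη1 (i + 1) (by omega) i.succ_ne_zero])
      have ha' : ∀ t ∈ Set.Ioo t0 (t0 + δ), deriv a t = (t - t0) ^ 2 * r t + 1 := fun t ht => by
        rw [hEq1 ht, ← Real.rpow_two, hr, rpow_mul_genPoly _ ht.1]
        simp [genPoly, Finset.sum_range_succ', h0, hc]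
      have hlim := (((((tendsto_sub_nhdsGT t0).pow 2).mul hL).add_const 2).mul hL).div
        (hu_lim.pow 2) (pow_ne_zero 2 hc0.ne')
      refine ⟨_, (hlim.const_mul 3).congr' ?_⟩
      filter_upwards [hIoo, hu_ne] with t ht hut
      have hpos := (sub_pos.mpr ht.1).ne'
      simp only [Pi.div_apply]
      rw [ha' t ht, ha_u t ht, h0, Real.rpow_one]
      field_simp
      ring
end

section
/- Suppose N ≥ 2. The quantity a(t)·ä(t) − ȧ(t)² has the following one-sided limit as t → t⊙ from the right: 0 if η₀ > 1; −c₀² if η₀ = 1; −∞ if 0 < η₀ < 1; 0 if η₀ = 0 and η₁ > 2; 2c₀c₁ if η₀ = 0 and η₁ = 2; +∞ if η₀ = 0, 1 < η₁ < 2 and c₁ > 0, and −∞ if η₀ = 0, 1 < η₁ < 2 and c₁ < 0; −c₁² if η₀ = 0, η₁ = 1 and η₂ > 2; 2c₀c₂ − c₁² if η₀ = 0, η₁ = 1 and η₂ = 2; +∞ if η₀ = 0, η₁ = 1, 1 < η₂ < 2 and c₂ > 0, and −∞ if c₂ < 0 in that case; −∞ if η₀ = 0, 0 < η₁ < 1 and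 c₁ > 0, and +∞ if c₁ < 0 in that case; +∞ if η₀ < 0. (The null energy condition at the milestone is the condition k ≥ a ä − ȧ², so this limit controls NEC satisfaction or violation.) -/
open Filter Topology

/-- The generalized power sum `∑ i ≤ N, d i * x ^ μ i`. -/
noncomputable def rpowSum (N : ℕ) (d μ : ℕ → ℝ) (x : ℝ) : ℝ :=
  ∑ i ∈ Finset.range (N + 1), d i * x ^ (μ i)

/-- Termwise differentiation of a generalized power sum on an interval to the right of `t0`. -/
theorem deriv_eq_rpowSum {t0 δ : ℝ} {N : ℕ} {d μ : ℕ → ℝ} {f : ℝ → ℝ}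
    (hf : ∀ t ∈ Set.Ioo t0 (t0 + δ), f t = rpowSum N d μ (t - t0)) :
    ∀ t ∈ Set.Ioo t0 (t0 + δ),
      deriv f t = rpowSum N (fun i => d i * μ i) (fun i => μ i - 1) (t - t0) := by
  intro t ht
  have hpos : t - t0 ≠ 0 := (sub_pos.2 ht.1).ne'
  have hev : f =ᶠ[𝓝 t] fun s => rpowSum N d μ (s - t0) := by
    filter_upwards [isOpen_Ioo.mem_nhds ht] with s hs using hf s hs
  rw [hev.deriv_eq]
  refine HasDerivAt.deriv ?_
  unfold rpowSum
  refine HasDerivAt.fun_sum fun i _ => ?_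
  have h := (((hasDerivAt_id t).sub_const t0).rpow_const (p := μ i) (Or.inl hpos)).const_mul (d i)
  exact h.congr_deriv (by simp only [id]; ring)

theorem tendsto_rpow_nhdsGT_zero {m : ℝ} (hm : 0 < m) :
    Tendsto (fun x : ℝ => x ^ m) (𝓝[>] 0) (𝓝 0) := by
  have h := (Real.continuousAt_rpow_const 0 m (Or.inr hm.le)).tendsto
  rw [Real.zero_rpow hm.ne'] at h
  exact h.mono_left nhdsWithin_le_nhds

/-- A generalized power sum divided by its leading power tends to the leading coefficient. -/
theorem tendsto_rpowSum_mul {N k : ℕ} {d μ : ℕ → ℝ} {m : ℝ} (hk : k ≤ N)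
    (hlow : ∀ i < k, d i = 0) (hm : μ k = m) (hhigh : ∀ i, k < i → i ≤ N → m < μ i) :
    Tendsto (fun x => rpowSum N d μ x * x ^ (-m)) (𝓝[>] 0) (𝓝 (d k)) := by
  have hsum : Tendsto (fun x : ℝ => ∑ i ∈ Finset.range (N + 1), d i * x ^ (μ i) * x ^ (-m))
      (𝓝[>] 0) (𝓝 (∑ i ∈ Finset.range (N + 1), if i = k then d k else 0)) := by
    refine tendsto_finsetSum _ fun i hi => ?_
    have hiN : i ≤ N := Nat.lt_succ_iff.1 (Finset.mem_range.1 hi)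
    have hcomb : (fun x : ℝ => d i * x ^ (μ i - m)) =ᶠ[𝓝[>] 0]
        fun x => d i * x ^ (μ i) * x ^ (-m) := by
      filter_upwards [self_mem_nhdsWithin] with x hx
      rw [sub_eq_add_neg, Real.rpow_add hx, mul_assoc]
    refine Tendsto.congr' hcomb ?_
    rcases lt_trichotomy i k with h | rfl | h
    · simp [hlow i h, h.ne]
    · simp [hm]
    · simpa [h.ne'] using
        (tendsto_rpow_nhdsGT_zero (sub_pos.2 (hhigh i h hiN))).const_mul (d i)
  have hval : (∑ i ∈ Finset.range (N + 1), if i = k then d k else 0) = d k := by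
    rw [Finset.sum_ite_eq' (Finset.range (N + 1)) k fun _ => d k,
      if_pos (Finset.mem_range.2 (Nat.lt_succ_of_le hk))]
  rw [hval] at hsum
  simpa only [rpowSum, Finset.sum_mul] using hsum

section LeadingPower

variable {F : ℝ → ℝ} {m L : ℝ}

theorem mul_rpow_neg_mul_rpow_eventuallyEq (F : ℝ → ℝ) (m : ℝ) :
    (fun x => F x * x ^ (-m) * x ^ m) =ᶠ[𝓝[>] 0] F := by
  filter_upwards [self_mem_nhdsWithin] with x hx
  rw [mul_assoc, ← Real.rpow_add hx, neg_add_cancel, Real.rpow_zero, mul_one]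

theorem tendsto_zero_of_leading (h : Tendsto (fun x => F x * x ^ (-m)) (𝓝[>] 0) (𝓝 L))
    (hm : 0 < m) : Tendsto F (𝓝[>] 0) (𝓝 0) := by
  refine Tendsto.congr' (mul_rpow_neg_mul_rpow_eventuallyEq F m) ?_
  simpa using h.mul (tendsto_rpow_nhdsGT_zero hm)

theorem tendsto_of_leading (h : Tendsto (fun x => F x * x ^ (-m)) (𝓝[>] 0) (𝓝 L))
    (hm : m = 0) : Tendsto F (𝓝[>] 0) (𝓝 L) := by
  simpa [hm] using h

theorem tendsto_atTop_of_leading (h : Tendsto (fun x => F x * x ^ (-m)) (𝓝[>] 0) (𝓝 L))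
    (hm : m < 0) (hL : 0 < L) : Tendsto F (𝓝[>] 0) atTop :=
  Tendsto.congr' (mul_rpow_neg_mul_rpow_eventuallyEq F m)
    (h.pos_mul_atTop hL (tendsto_rpow_neg_nhdsGT_zero hm))

theorem tendsto_atBot_of_leading (h : Tendsto (fun x => F x * x ^ (-m)) (𝓝[>] 0) (𝓝 L))
    (hm : m < 0) (hL : L < 0) : Tendsto F (𝓝[>] 0) atBot :=
  Tendsto.congr' (mul_rpow_neg_mul_rpow_eventuallyEq F m)
    (h.neg_mul_atTop hL (tendsto_rpow_neg_nhdsGT_zero hm))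

end LeadingPower

section Combination

variable {A B C : ℝ → ℝ} {p q r m P Q R : ℝ}

/-- Leading behaviour of `A * C - B ^ 2` when both terms have the same leading power. -/
theorem tendsto_mul_sub_sq_of_eq (hA : Tendsto (fun x => A x * x ^ (-p)) (𝓝[>] 0) (𝓝 P))
    (hB : Tendsto (fun x => B x * x ^ (-q)) (𝓝[>] 0) (𝓝 Q))
    (hC : Tendsto (fun x => C x * x ^ (-r)) (𝓝[>] 0) (𝓝 R))
    (hpr : p + r = m) (hq : 2 * q = m) :
    Tendsto (fun x => (A x * C x - B x ^ 2) * x ^ (-m)) (𝓝[>] 0) (𝓝 (P * R - Q ^ 2)) := by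
  refine Tendsto.congr' ?_ ((hA.mul hC).sub (hB.pow 2))
  filter_upwards [self_mem_nhdsWithin] with x hx
  have h1 : x ^ (-m) = x ^ (-p) * x ^ (-r) := by
    rw [← Real.rpow_add hx, ← hpr]; congr 1; ring
  have h2 : x ^ (-m) = x ^ (-q) * x ^ (-q) := by
    rw [← Real.rpow_add hx, ← hq]; congr 1; ring
  rw [sub_mul]
  nth_rewrite 1 [h1]
  rw [h2]
  ring

/-- Leading behaviour of `A * C - B ^ 2` when `A * C` dominates. -/
theorem tendsto_mul_sub_sq_of_lt (hA : Tendsto (fun x => A x * x ^ (-p)) (𝓝[>] 0) (𝓝 P))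
    (hB : Tendsto (fun x => B x * x ^ (-q)) (𝓝[>] 0) (𝓝 Q))
    (hC : Tendsto (fun x => C x * x ^ (-r)) (𝓝[>] 0) (𝓝 R))
    (hpr : p + r = m) (hq : m < 2 * q) :
    Tendsto (fun x => (A x * C x - B x ^ 2) * x ^ (-m)) (𝓝[>] 0) (𝓝 (P * R)) := by
  have hB' : Tendsto (fun x => B x * x ^ (-(m / 2))) (𝓝[>] 0) (𝓝 0) := by
    refine tendsto_zero_of_leading (m := q - m / 2) (L := Q) ?_ (by linarith)
    refine Tendsto.congr' ?_ hB
    filter_upwards [self_mem_nhdsWithin] with x hx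
    rw [mul_assoc, ← Real.rpow_add hx]
    congr 2
    ring
  simpa using tendsto_mul_sub_sq_of_eq hA hB' hC hpr (by ring)

end Combination

/-- One-sided limit of `a ä − ȧ²` at a generic cosmological milestone described by
a generalized power-series scale factor.  (The NEC at the milestone reads
`k ≥ a ä − ȧ²`, so this limit controls NEC satisfaction or violation.) -/
theorem limit_of_NEC_combination
    (t0 δ : ℝ) (N : ℕ) (η c : ℕ → ℝ) (a : ℝ → ℝ)
    (hN : 2 ≤ N)
    (hδ : 0 < δ)
    (hηmono : ∀ i j : ℕ, i < j → j ≤ N → η i < η j)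
    (hc0 : 0 < c 0)
    (hcne : ∀ i : ℕ, i ≤ N → c i ≠ 0)
    (ha : ∀ t ∈ Set.Ioo t0 (t0 + δ),
      a t = ∑ i ∈ Finset.range (N + 1), c i * (t - t0) ^ (η i)) :
    (1 < η 0 →
      Tendsto (fun t => a t * deriv (deriv a) t - (deriv a t) ^ 2) (𝓝[>] t0) (𝓝 0)) ∧
    (η 0 = 1 →
      Tendsto (fun t => a t * deriv (deriv a) t - (deriv a t) ^ 2) (𝓝[>] t0)
        (𝓝 (-(c 0) ^ 2))) ∧
    (0 < η 0 ∧ η 0 < 1 →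
      Tendsto (fun t => a t * deriv (deriv a) t - (deriv a t) ^ 2) (𝓝[>] t0) atBot) ∧
    (η 0 = 0 ∧ 2 < η 1 →
      Tendsto (fun t => a t * deriv (deriv a) t - (deriv a t) ^ 2) (𝓝[>] t0) (𝓝 0)) ∧
    (η 0 = 0 ∧ η 1 = 2 →
      Tendsto (fun t => a t * deriv (deriv a) t - (deriv a t) ^ 2) (𝓝[>] t0)
        (𝓝 (2 * c 0 * c 1))) ∧
    (η 0 = 0 ∧ 1 < η 1 ∧ η 1 < 2 →
      (0 < c 1 →
        Tendsto (fun t => a t * deriv (deriv a) t - (deriv a t) ^ 2) (𝓝[>] t0) atTop) ∧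
      (c 1 < 0 →
        Tendsto (fun t => a t * deriv (deriv a) t - (deriv a t) ^ 2) (𝓝[>] t0) atBot)) ∧
    (η 0 = 0 ∧ η 1 = 1 ∧ 2 < η 2 →
      Tendsto (fun t => a t * deriv (deriv a) t - (deriv a t) ^ 2) (𝓝[>] t0)
        (𝓝 (-(c 1) ^ 2))) ∧
    (η 0 = 0 ∧ η 1 = 1 ∧ η 2 = 2 →
      Tendsto (fun t => a t * deriv (deriv a) t - (deriv a t) ^ 2) (𝓝[>] t0)
        (𝓝 (2 * c 0 * c 2 - (c 1) ^ 2))) ∧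
    (η 0 = 0 ∧ η 1 = 1 ∧ 1 < η 2 ∧ η 2 < 2 →
      (0 < c 2 →
        Tendsto (fun t => a t * deriv (deriv a) t - (deriv a t) ^ 2) (𝓝[>] t0) atTop) ∧
      (c 2 < 0 →
        Tendsto (fun t => a t * deriv (deriv a) t - (deriv a t) ^ 2) (𝓝[>] t0) atBot)) ∧
    (η 0 = 0 ∧ 0 < η 1 ∧ η 1 < 1 →
      (0 < c 1 →
        Tendsto (fun t => a t * deriv (deriv a) t - (deriv a t) ^ 2) (𝓝[>] t0) atBot) ∧
      (c 1 < 0 →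
        Tendsto (fun t => a t * deriv (deriv a) t - (deriv a t) ^ 2) (𝓝[>] t0) atTop)) ∧
    (η 0 < 0 →
      Tendsto (fun t => a t * deriv (deriv a) t - (deriv a t) ^ 2) (𝓝[>] t0) atTop) := by
  let A : ℝ → ℝ := rpowSum N c η
  let B : ℝ → ℝ := rpowSum N (fun i => c i * η i) (fun i => η i - 1)
  let C : ℝ → ℝ := rpowSum N (fun i => c i * η i * (η i - 1)) (fun i => η i - 1 - 1)
  let F : ℝ → ℝ := fun x => A x * C x - B x ^ 2
  have key : ∀ {l : Filter ℝ}, Tendsto F (𝓝[>] 0) l →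
      Tendsto (fun t => a t * deriv (deriv a) t - (deriv a t) ^ 2) (𝓝[>] t0) l := by
    intro l hl
    have hshift : Tendsto (fun t => t - t0) (𝓝[>] t0) (𝓝[>] 0) := by
      refine tendsto_nhdsWithin_iff.2 ⟨?_, ?_⟩
      · have h : Tendsto (fun t => t - t0) (𝓝 t0) (𝓝 (t0 - t0)) :=
          (continuous_id.sub continuous_const).tendsto t0
        rw [sub_self] at h
        exact h.mono_left nhdsWithin_le_nhds
      · filter_upwards [self_mem_nhdsWithin] with t ht using sub_pos.2 (Set.mem_Ioi.1 ht)
    refine Tendsto.congr' ?_ (hl.comp hshift)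
    have hda := deriv_eq_rpowSum (d := c) (μ := η) ha
    have hdda := deriv_eq_rpowSum hda
    filter_upwards [Ioo_mem_nhdsGT (lt_add_of_pos_right t0 hδ)] with t ht
    rw [hdda t ht, hda t ht, ha t ht]
    rfl
  have h01 : η 0 < η 1 := hηmono 0 1 (by norm_num) (by omega)
  have h12 : η 1 < η 2 := hηmono 1 2 (by norm_num) hN
  have hA : Tendsto (fun x => A x * x ^ (-η 0)) (𝓝[>] 0) (𝓝 (c 0)) :=
    tendsto_rpowSum_mul (Nat.zero_le N) (fun i hi => absurd hi (Nat.not_lt_zero i)) rfl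
      fun i hi hiN => hηmono 0 i hi hiN
  have hB : ∀ k ≤ N, (∀ i < k, c i * η i = 0) →
      Tendsto (fun x => B x * x ^ (-(η k - 1))) (𝓝[>] 0) (𝓝 (c k * η k)) :=
    fun k hk hlow => tendsto_rpowSum_mul hk hlow rfl
      fun i hi hiN => by linarith [hηmono k i hi hiN]
  have hC : ∀ k ≤ N, (∀ i < k, c i * η i * (η i - 1) = 0) →
      Tendsto (fun x => C x * x ^ (-(η k - 1 - 1))) (𝓝[>] 0)
        (𝓝 (c k * η k * (η k - 1))) :=
    fun k hk hlow => tendsto_rpowSum_mul hk hlow rfl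
      fun i hi hiN => by linarith [hηmono k i hi hiN]
  have hF0 : Tendsto (fun x => F x * x ^ (-(2 * (η 0 - 1)))) (𝓝[>] 0)
      (𝓝 (-(c 0) ^ 2 * η 0)) := by
    have h := tendsto_mul_sub_sq_of_eq (m := 2 * (η 0 - 1)) hA
      (hB 0 (by omega) (by simp)) (hC 0 (by omega) (by simp)) (by ring) rfl
    convert h using 2
    ring
  have hF1 : η 0 = 0 → Tendsto (fun x => F x * x ^ (-(η 1 - 2))) (𝓝[>] 0)
      (𝓝 (c 0 * (c 1 * η 1 * (η 1 - 1)))) := fun h0 =>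
    tendsto_mul_sub_sq_of_lt hA
      (hB 1 (by omega) (by simp [h0])) (hC 1 (by omega) (by simp [h0]))
      (by rw [h0]; ring) (by linarith)
  have hA0 : η 0 = 0 → Tendsto A (𝓝[>] 0) (𝓝 (c 0)) := fun h0 => tendsto_of_leading hA h0
  have hB1 : η 0 = 0 → η 1 = 1 → Tendsto B (𝓝[>] 0) (𝓝 (c 1)) := fun h0 h1 => by
    simpa [h1] using hB 1 (by omega) (by simp [h0])
  have hC2 : η 0 = 0 → η 1 = 1 → Tendsto (fun x => C x * x ^ (-(η 2 - 1 - 1))) (𝓝[>] 0)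
      (𝓝 (c 2 * η 2 * (η 2 - 1))) := fun h0 h1 => by
    refine hC 2 hN fun i hi => ?_
    interval_cases i <;> simp [h0, h1]
  have hF2 : η 0 = 0 → η 1 = 1 → η 2 < 2 →
      Tendsto (fun x => F x * x ^ (-(η 2 - 2))) (𝓝[>] 0)
        (𝓝 (c 0 * (c 2 * η 2 * (η 2 - 1)))) := fun h0 h1 h2 =>
    tendsto_mul_sub_sq_of_lt hA (hB 1 (by omega) (by simp [h0])) (hC2 h0 h1)
      (by rw [h0]; ring) (by rw [h1]; linarith)
  refine ⟨?_, ?_, ?_, ?_, ?_, ?_, ?_, ?_, ?_, ?_, ?_⟩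
  · intro h
    exact key (tendsto_zero_of_leading hF0 (by linarith))
  · intro h
    simpa [h] using key (tendsto_of_leading hF0 (by rw [h]; norm_num))
  · rintro ⟨h, h'⟩
    exact key (tendsto_atBot_of_leading hF0 (by linarith)
      (mul_neg_of_neg_of_pos (neg_neg_of_pos (pow_pos hc0 2)) h))
  · rintro ⟨h0, h1⟩
    exact key (tendsto_zero_of_leading (hF1 h0) (by linarith))
  · rintro ⟨h0, h1⟩
    convert key (tendsto_of_leading (hF1 h0) (by rw [h1]; norm_num)) using 2
    rw [h1]
    ring
  · rintro ⟨h0, h1, h1'⟩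
    have hp : 0 < η 1 * (η 1 - 1) := mul_pos (by linarith) (by linarith)
    refine ⟨fun hc => key (tendsto_atTop_of_leading (hF1 h0) (by linarith) ?_),
      fun hc => key (tendsto_atBot_of_leading (hF1 h0) (by linarith) ?_)⟩ <;> rw [mul_assoc (c 1)]
    · exact mul_pos hc0 (mul_pos hc hp)
    · exact mul_neg_of_pos_of_neg hc0 (mul_neg_of_neg_of_pos hc hp)
  · rintro ⟨h0, h1, h2⟩
    have hC0 : Tendsto C (𝓝[>] 0) (𝓝 0) :=
      tendsto_zero_of_leading (hC2 h0 h1) (by linarith)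
    simpa using key (((hA0 h0).mul hC0).sub ((hB1 h0 h1).pow 2))
  · rintro ⟨h0, h1, h2⟩
    have hC0 := tendsto_of_leading (hC2 h0 h1) (by rw [h2]; norm_num)
    convert key (((hA0 h0).mul hC0).sub ((hB1 h0 h1).pow 2)) using 2
    rw [h2]
    ring
  · rintro ⟨h0, h1, h2, h2'⟩
    have hp : 0 < η 2 * (η 2 - 1) := mul_pos (by linarith) (by linarith)
    refine ⟨fun hc => key (tendsto_atTop_of_leading (hF2 h0 h1 h2') (by linarith) ?_),
      fun hc => key (tendsto_atBot_of_leading (hF2 h0 h1 h2') (by linarith) ?_)⟩ <;>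
      rw [mul_assoc (c 2)]
    · exact mul_pos hc0 (mul_pos hc hp)
    · exact mul_neg_of_pos_of_neg hc0 (mul_neg_of_neg_of_pos hc hp)
  · rintro ⟨h0, h1, h1'⟩
    have hp : η 1 * (η 1 - 1) < 0 := mul_neg_of_pos_of_neg h1 (by linarith)
    refine ⟨fun hc => key (tendsto_atBot_of_leading (hF1 h0) (by linarith) ?_),
      fun hc => key (tendsto_atTop_of_leading (hF1 h0) (by linarith) ?_)⟩ <;> rw [mul_assoc (c 1)]
    · exact mul_neg_of_pos_of_neg hc0 (mul_neg_of_pos_of_neg hc hp)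
    · exact mul_pos hc0 (mul_pos_of_neg_of_neg hc hp)
  · intro h
    exact key (tendsto_atTop_of_leading hF0 (by linarith)
      (mul_pos_of_neg_of_neg (neg_neg_of_pos (pow_pos hc0 2)) h))
end

section
/- (Big rips always violate the null energy condition.) Suppose η₀ < 0, let k ∈ ℝ, and define ρ(t) = 3(ȧ(t)²/a(t)² + k/a(t)²) and p(t) = −2ä(t)/a(t) − ȧ(t)²/a(t)² − k/a(t)² on (t⊙, t⊙ + δ). Then ρ(t) + p(t) → −∞ as t → t⊙ from the right; in particular, for every M ∈ ℝ there is ε ∈ (0, δ) with ρ(t) + p(t) < M for all t ∈ (t⊙, t⊙ + ε), so the null energy condition ρ + p ≥ 0 is violated in a neighbourhood of the big rip. -/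
open Filter Topology

/-- A generalized power sum divided by its leading power tends to its leading coefficient. -/
theorem tendsto_sum_mul_rpow_div_leading (N : ℕ) (η d : ℕ → ℝ) (x : ℝ)
    (hη : ∀ i, 0 < i → i ≤ N → η 0 < η i) :
    Tendsto (fun t => (∑ i ∈ Finset.range (N + 1), d i * (t - x) ^ (η i)) * (t - x) ^ (-η 0))
      (𝓝[>] x) (𝓝 (d 0)) := by
  have hsub : Tendsto (fun t : ℝ => t - x) (𝓝[>] x) (𝓝 0) :=
    ((continuous_id.sub continuous_const).tendsto' x 0 (sub_self x)).mono_left nhdsWithin_le_nhds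
  have hterm : ∀ i ∈ Finset.range N,
      Tendsto (fun t => d (i + 1) * (t - x) ^ (η (i + 1) - η 0)) (𝓝[>] x) (𝓝 0) := by
    intro i hi
    have h : 0 < η (i + 1) - η 0 :=
      sub_pos.2 (hη _ i.succ_pos (Nat.succ_le_of_lt (Finset.mem_range.1 hi)))
    simpa [Real.zero_rpow h.ne'] using
      ((hsub.rpow_const (p := η (i + 1) - η 0) (Or.inr h.le)).const_mul (d (i + 1)))
  have hsum := (tendsto_finsetSum _ hterm).add_const (d 0)
  rw [Finset.sum_const_zero, zero_add] at hsum
  refine hsum.congr' ?_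
  filter_upwards [self_mem_nhdsWithin] with t ht
  have hpos : 0 < t - x := sub_pos.2 ht
  have hmul (i : ℕ) : d i * (t - x) ^ (η i) * (t - x) ^ (-η 0)
      = d i * (t - x) ^ (η i - η 0) := by
    rw [mul_assoc, ← Real.rpow_add hpos, ← sub_eq_add_neg]
  rw [Finset.sum_mul, Finset.sum_range_succ']
  simp only [hmul, sub_self, Real.rpow_zero, mul_one]

/-- Termwise differentiation of a generalized power sum on a right neighbourhood of its base
point. -/
theorem deriv_eq_sum_mul_rpow (N : ℕ) (η d : ℕ → ℝ) (x y : ℝ) (f : ℝ → ℝ)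
    (hf : ∀ t ∈ Set.Ioo x y, f t = ∑ i ∈ Finset.range (N + 1), d i * (t - x) ^ (η i)) :
    ∀ t ∈ Set.Ioo x y,
      deriv f t = ∑ i ∈ Finset.range (N + 1), (d i * η i) * (t - x) ^ (η i - 1) := by
  intro t ht
  have hloc : f =ᶠ[𝓝 t] fun t => ∑ i ∈ Finset.range (N + 1), d i * (t - x) ^ (η i) := by
    filter_upwards [isOpen_Ioo.mem_nhds ht] with u hu using hf u hu
  rw [hloc.deriv_eq]
  refine (HasDerivAt.fun_sum fun i _ => ?_).deriv
  have h := (((hasDerivAt_id t).sub_const x).rpow_const (p := η i)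
    (Or.inl (sub_pos.2 ht.1).ne')).const_mul (d i)
  exact h.congr_deriv (by simp only [id, one_mul, mul_assoc])

/-- Big rips always violate the null energy condition: if `η₀ < 0` then
`ρ + p → −∞` as `t → t⊙⁺`; in particular `ρ + p < M` eventually, so the NEC
`ρ + p ≥ 0` fails in a neighbourhood of the big rip. -/
theorem big_rip_violates_NEC
    (t0 δ k : ℝ) (N : ℕ) (η c : ℕ → ℝ) (a ρ p : ℝ → ℝ)
    (hδ : 0 < δ)
    (hηmono : ∀ i j : ℕ, i < j → j ≤ N → η i < η j)
    (hc0 : 0 < c 0)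
    (hcne : ∀ i : ℕ, i ≤ N → c i ≠ 0)
    (ha : ∀ t ∈ Set.Ioo t0 (t0 + δ),
      a t = ∑ i ∈ Finset.range (N + 1), c i * (t - t0) ^ (η i))
    (hη0 : η 0 < 0)
    (hρ : ∀ t ∈ Set.Ioo t0 (t0 + δ),
      ρ t = 3 * ((deriv a t) ^ 2 / (a t) ^ 2 + k / (a t) ^ 2))
    (hp : ∀ t ∈ Set.Ioo t0 (t0 + δ),
      p t = -2 * deriv (deriv a) t / a t - (deriv a t) ^ 2 / (a t) ^ 2 - k / (a t) ^ 2) :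
    Tendsto (fun t => ρ t + p t) (𝓝[>] t0) atBot ∧
    ∀ M : ℝ, ∃ ε : ℝ, 0 < ε ∧ ε < δ ∧
      ∀ t ∈ Set.Ioo t0 (t0 + ε), ρ t + p t < M := by
  have hd := deriv_eq_sum_mul_rpow N η c t0 (t0 + δ) a ha
  have hdd := deriv_eq_sum_mul_rpow N (fun i => η i - 1) (fun i => c i * η i) t0 (t0 + δ) _ hd
  have hη (i : ℕ) (hi : 0 < i) (hiN : i ≤ N) : η 0 < η i := hηmono 0 i hi hiN
  have hnear : Set.Ioo t0 (t0 + δ) ∈ 𝓝[>] t0 := Ioo_mem_nhdsGT (by linarith)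
  have hpow (t : ℝ) (ht : t ∈ Set.Ioo t0 (t0 + δ)) :
      (t - t0) ^ (-(η 0 - 1)) = (t - t0) * (t - t0) ^ (-η 0) ∧
      (t - t0) ^ (-(η 0 - 1 - 1)) = (t - t0) ^ 2 * (t - t0) ^ (-η 0) := by
    have hpos : 0 < t - t0 := sub_pos.2 ht.1
    constructor
    · rw [show -(η 0 - 1) = 1 + -η 0 by ring, Real.rpow_add hpos, Real.rpow_one]
    · rw [show -(η 0 - 1 - 1) = 2 + -η 0 by ring, Real.rpow_add hpos, Real.rpow_two]
  have h0 : Tendsto (fun t => a t * (t - t0) ^ (-η 0)) (𝓝[>] t0) (𝓝 (c 0)) := by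
    refine (tendsto_sum_mul_rpow_div_leading N η c t0 hη).congr' ?_
    filter_upwards [hnear] with t ht
    rw [ha t ht]
  have h1 : Tendsto (fun t => deriv a t * ((t - t0) * (t - t0) ^ (-η 0))) (𝓝[>] t0)
      (𝓝 (c 0 * η 0)) := by
    refine (tendsto_sum_mul_rpow_div_leading N (fun i => η i - 1) (fun i => c i * η i) t0
      fun i hi hiN => sub_lt_sub_right (hη i hi hiN) 1).congr' ?_
    filter_upwards [hnear] with t ht
    rw [hd t ht, ← (hpow t ht).1]
  have h2 : Tendsto (fun t => deriv (deriv a) t * ((t - t0) ^ 2 * (t - t0) ^ (-η 0))) (𝓝[>] t0)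
      (𝓝 (c 0 * η 0 * (η 0 - 1))) := by
    refine (tendsto_sum_mul_rpow_div_leading N (fun i => η i - 1 - 1)
      (fun i => c i * η i * (η i - 1)) t0
      fun i hi hiN => sub_lt_sub_right (sub_lt_sub_right (hη i hi hiN) 1) 1).congr' ?_
    filter_upwards [hnear] with t ht
    rw [hdd t ht, ← (hpow t ht).2]
  have hsub : Tendsto (fun t : ℝ => t - t0) (𝓝[>] t0) (𝓝[>] 0) := by
    refine tendsto_nhdsWithin_of_tendsto_nhds_of_eventually_within _ ?_ ?_
    · exact ((continuous_id.sub continuous_const).tendsto' t0 0 (sub_self t0)).mono_left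
        nhdsWithin_le_nhds
    · filter_upwards [self_mem_nhdsWithin] with t ht using sub_pos.2 (Set.mem_Ioi.1 ht)
  have hsub0 := hsub.mono_right nhdsWithin_le_nhds
  have hu : Tendsto (fun t : ℝ => (t - t0) ^ (-η 0)) (𝓝[>] t0) (𝓝 0) := by
    have h := hsub0.rpow_const (p := -η 0) (Or.inr (by linarith))
    rwa [Real.zero_rpow (by linarith)] at h
  have hlim := (((h1.div h0 hc0.ne').pow 2).sub (h2.div h0 hc0.ne')).add
    ((((hsub0.mul hu).div h0 hc0.ne').pow 2).const_mul k)
  have hlim2 := hlim.const_mul 2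
  rw [show 2 * ((c 0 * η 0 / c 0) ^ 2 - c 0 * η 0 * (η 0 - 1) / c 0 + k * (0 * 0 / c 0) ^ 2)
    = 2 * η 0 by field_simp; ring] at hlim2
  have hinv : Tendsto (fun t : ℝ => ((t - t0)⁻¹) ^ 2) (𝓝[>] t0) atTop :=
    (tendsto_pow_atTop two_ne_zero).comp (tendsto_inv_nhdsGT_zero.comp hsub)
  have hmain : Tendsto (fun t => ρ t + p t) (𝓝[>] t0) atBot := by
    refine (hlim2.neg_mul_atTop (by linarith) hinv).congr' ?_
    filter_upwards [hnear, h0.eventually_ne hc0.ne'] with t ht hat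
    have hs : t - t0 ≠ 0 := (sub_pos.2 ht.1).ne'
    have ha0 : a t ≠ 0 := left_ne_zero_of_mul hat
    have hu0 : (t - t0) ^ (-η 0) ≠ 0 := right_ne_zero_of_mul hat
    simp only [Pi.div_apply]
    rw [hρ t ht, hp t ht]
    generalize (t - t0) ^ (-η 0) = u at hu0 ⊢
    field_simp
    ring
  refine ⟨hmain, fun M => ?_⟩
  obtain ⟨b, hb, hbM⟩ := mem_nhdsGT_iff_exists_Ioo_subset.1 (hmain.eventually_lt_atBot M)
  have hb0 : 0 < b - t0 := sub_pos.2 hb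
  refine ⟨min (b - t0) (δ / 2), lt_min hb0 (half_pos hδ),
    (min_le_right _ _).trans_lt (half_lt_self hδ), fun t ht => hbM ⟨ht.1, ?_⟩⟩
  linarith [ht.2, min_le_left (b - t0) (δ / 2)]
end

section
/- Suppose N ≥ 2. There exists ε ∈ (0, δ) such that for all t ∈ (t⊙, t⊙ + ε) the sign of ä(t) is: positive if η₀ > 1; equal to the sign of c₁ if η₀ = 1; negative if 0 < η₀ < 1; equal to the sign of η₁(η₁ − 1)c₁ if η₀ = 0 and η₁ ≠ 1; equal to the sign of c₂ if η₀ = 0 and η₁ = 1; positive if η₀ < 0. (Since the strong energy condition requires ä ≤ 0 in addition to the NEC, this eventual sign controls SEC satisfaction near the milestone.) -/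
open Filter Topology

/-- The second derivative of a function given by a finite sum of real powers of `t - t0`. -/
theorem deriv_deriv_sum_rpow {t0 δ : ℝ} {s : Finset ℕ} {η c : ℕ → ℝ} {a : ℝ → ℝ}
    (ha : ∀ t ∈ Set.Ioo t0 (t0 + δ), a t = ∑ i ∈ s, c i * (t - t0) ^ (η i))
    {t : ℝ} (ht : t ∈ Set.Ioo t0 (t0 + δ)) :
    deriv (deriv a) t = ∑ i ∈ s, η i * (η i - 1) * c i * (t - t0) ^ (η i - 2) := by
  have key : ∀ (b ζ : ℕ → ℝ) (f : ℝ → ℝ),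
      (∀ t ∈ Set.Ioo t0 (t0 + δ), f t = ∑ i ∈ s, b i * (t - t0) ^ (ζ i)) →
      ∀ t ∈ Set.Ioo t0 (t0 + δ), deriv f t = ∑ i ∈ s, b i * ζ i * (t - t0) ^ (ζ i - 1) := by
    intro b ζ f hf t ht
    have hE : f =ᶠ[𝓝 t] fun t => ∑ i ∈ s, b i * (t - t0) ^ (ζ i) :=
      Filter.eventually_of_mem (isOpen_Ioo.mem_nhds ht) hf
    rw [hE.deriv_eq]
    refine (HasDerivAt.fun_sum fun i _ => ?_).deriv
    have h := (((hasDerivAt_id t).sub_const t0).rpow_const (p := ζ i)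
      (Or.inl (sub_pos.mpr ht.1).ne')).const_mul (b i)
    refine h.congr_deriv ?_
    simp only [id]
    ring
  rw [key _ _ _ (key c η a ha) t ht]
  refine Finset.sum_congr rfl fun i _ => ?_
  rw [show η i - 1 - 1 = η i - 2 by ring]
  ring

/-- A finite sum of real powers has, just to the right of `t0`, the sign of its first nonzero
coefficient. -/
theorem eventually_sign_sum_rpow {t0 : ℝ} {s : Finset ℕ} {ζ b : ℕ → ℝ} {k : ℕ} (hk : k ∈ s)
    (hζ : ∀ i ∈ s, k < i → ζ k < ζ i) (hb : ∀ i < k, b i = 0) (hbk : b k ≠ 0) :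
    ∀ᶠ t in 𝓝[>] t0, Real.sign (∑ i ∈ s, b i * (t - t0) ^ (ζ i)) = Real.sign (b k) := by
  have hsub : Tendsto (fun t : ℝ => t - t0) (𝓝[>] t0) (𝓝 0) := by
    have h : ContinuousAt (fun t : ℝ => t - t0) t0 := by fun_prop
    simpa [ContinuousAt] using h.tendsto.mono_left nhdsWithin_le_nhds
  have hlim : Tendsto (fun t : ℝ => ∑ i ∈ s, b i * (t - t0) ^ (ζ i - ζ k)) (𝓝[>] t0)
      (𝓝 (b k)) := by
    have h : Tendsto (fun t : ℝ => ∑ i ∈ s, b i * (t - t0) ^ (ζ i - ζ k)) (𝓝[>] t0)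
        (𝓝 (∑ i ∈ s, if i = k then b k else 0)) := by
      refine tendsto_finsetSum _ fun i hi => ?_
      rcases lt_trichotomy i k with h | rfl | h
      · simp [hb i h, h.ne]
      · simp
      · have hpos : 0 < ζ i - ζ k := sub_pos.mpr (hζ i hi h)
        have h2 := (hsub.rpow_const (p := ζ i - ζ k) (Or.inr hpos.le)).const_mul (b i)
        simpa [h.ne', Real.zero_rpow hpos.ne'] using h2
    simpa [hk] using h
  have hfac : ∀ t > t0, ∑ i ∈ s, b i * (t - t0) ^ (ζ i) =
      (t - t0) ^ (ζ k) * ∑ i ∈ s, b i * (t - t0) ^ (ζ i - ζ k) := by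
    intro t ht
    rw [Finset.mul_sum]
    refine Finset.sum_congr rfl fun i _ => ?_
    rw [mul_left_comm, ← Real.rpow_add (sub_pos.mpr ht), add_sub_cancel]
  rcases hbk.lt_or_gt with h | h
  · filter_upwards [hlim.eventually_lt_const h, self_mem_nhdsWithin] with t h1 ht
    rw [hfac t ht, Real.sign_of_neg h, Real.sign_of_neg]
    exact mul_neg_of_pos_of_neg (Real.rpow_pos_of_pos (sub_pos.mpr ht) _) h1
  · filter_upwards [hlim.eventually_const_lt h, self_mem_nhdsWithin] with t h1 ht
    rw [hfac t ht, Real.sign_of_pos h, Real.sign_of_pos]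
    exact mul_pos (Real.rpow_pos_of_pos (sub_pos.mpr ht) _) h1

theorem Real.pos_of_sign_eq {x y : ℝ} (h : Real.sign x = Real.sign y) (hy : 0 < y) : 0 < x := by
  rw [Real.sign_of_pos hy] at h
  rcases lt_trichotomy x 0 with hx | rfl | hx
  · rw [Real.sign_of_neg hx] at h; norm_num at h
  · simp at h
  · exact hx

theorem Real.neg_of_sign_eq {x y : ℝ} (h : Real.sign x = Real.sign y) (hy : y < 0) : x < 0 := by
  refine neg_pos.mp (Real.pos_of_sign_eq (y := -y) ?_ (neg_pos.mpr hy))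
  rw [Real.sign_neg, Real.sign_neg, h]

theorem Real.sign_mul_of_pos_left {x y : ℝ} (hx : 0 < x) : Real.sign (x * y) = Real.sign y := by
  rcases lt_trichotomy y 0 with hy | rfl | hy
  · rw [Real.sign_of_neg hy, Real.sign_of_neg (mul_neg_of_pos_of_neg hx hy)]
  · simp
  · rw [Real.sign_of_pos hy, Real.sign_of_pos (mul_pos hx hy)]

/-- Eventual sign of `ä` just after a generic cosmological milestone described by a
generalized power-series scale factor.  (The SEC requires `ä ≤ 0` in addition to
the NEC, so this eventual sign controls SEC satisfaction near the milestone.) -/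
theorem eventual_sign_of_acceleration
    (t0 δ : ℝ) (N : ℕ) (η c : ℕ → ℝ) (a : ℝ → ℝ)
    (hN : 2 ≤ N)
    (hδ : 0 < δ)
    (hηmono : ∀ i j : ℕ, i < j → j ≤ N → η i < η j)
    (hc0 : 0 < c 0)
    (hcne : ∀ i : ℕ, i ≤ N → c i ≠ 0)
    (ha : ∀ t ∈ Set.Ioo t0 (t0 + δ),
      a t = ∑ i ∈ Finset.range (N + 1), c i * (t - t0) ^ (η i)) :
    ∃ ε : ℝ, 0 < ε ∧ ε < δ ∧ ∀ t ∈ Set.Ioo t0 (t0 + ε),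
      (1 < η 0 → 0 < deriv (deriv a) t) ∧
      (η 0 = 1 → Real.sign (deriv (deriv a) t) = Real.sign (c 1)) ∧
      (0 < η 0 ∧ η 0 < 1 → deriv (deriv a) t < 0) ∧
      (η 0 = 0 ∧ η 1 ≠ 1 →
        Real.sign (deriv (deriv a) t) = Real.sign (η 1 * (η 1 - 1) * c 1)) ∧
      (η 0 = 0 ∧ η 1 = 1 → Real.sign (deriv (deriv a) t) = Real.sign (c 2)) ∧
      (η 0 < 0 → 0 < deriv (deriv a) t) := by
  have h01 := hηmono 0 1 one_pos (by omega)
  have h12 := hηmono 1 2 one_lt_two hN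
  have hc1 := hcne 1 (by omega)
  have hc2 := hcne 2 hN
  have key : ∀ k ≤ N, (∀ i < k, η i * (η i - 1) * c i = 0) → η k * (η k - 1) * c k ≠ 0 →
      ∀ᶠ t in 𝓝[>] t0, Real.sign (deriv (deriv a) t) = Real.sign (η k * (η k - 1) * c k) := by
    intro k hk hlt hne
    filter_upwards [eventually_sign_sum_rpow (t0 := t0) (s := Finset.range (N + 1))
        (ζ := fun i => η i - 2) (b := fun i => η i * (η i - 1) * c i)
        (Finset.mem_range.mpr (by omega))
        (fun i hi h => sub_lt_sub_right (hηmono k i h (by have := Finset.mem_range.mp hi; omega)) 2)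
        hlt hne, Ioo_mem_nhdsGT (show t0 < t0 + δ by linarith)] with t h ht
    rw [deriv_deriv_sum_rpow ha ht, h]
  have key0 (h0 : η 0 ≠ 0) (h1 : η 0 ≠ 1) := key 0 (Nat.zero_le N) (by simp)
    (mul_ne_zero (mul_ne_zero h0 (sub_ne_zero.mpr h1)) hc0.ne')
  have main : ∀ᶠ t in 𝓝[>] t0,
      (1 < η 0 → 0 < deriv (deriv a) t) ∧
      (η 0 = 1 → Real.sign (deriv (deriv a) t) = Real.sign (c 1)) ∧
      (0 < η 0 ∧ η 0 < 1 → deriv (deriv a) t < 0) ∧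
      (η 0 = 0 ∧ η 1 ≠ 1 →
        Real.sign (deriv (deriv a) t) = Real.sign (η 1 * (η 1 - 1) * c 1)) ∧
      (η 0 = 0 ∧ η 1 = 1 → Real.sign (deriv (deriv a) t) = Real.sign (c 2)) ∧
      (η 0 < 0 → 0 < deriv (deriv a) t) := by
    simp only [eventually_and, eventually_imp_distrib_left]
    refine ⟨fun h => ?_, fun h => ?_, fun h => ?_, fun h => ?_, fun h => ?_, fun h => ?_⟩
    · filter_upwards [key0 (by linarith) h.ne'] with t ht
      exact Real.pos_of_sign_eq ht (mul_pos (mul_pos (by linarith) (by linarith)) hc0)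
    · have hp : 0 < η 1 * (η 1 - 1) := mul_pos (by linarith) (by linarith)
      filter_upwards [key 1 (by omega) (by simp [h]) (mul_ne_zero hp.ne' hc1)] with t ht
      rw [ht, Real.sign_mul_of_pos_left hp]
    · filter_upwards [key0 h.1.ne' h.2.ne] with t ht
      exact Real.neg_of_sign_eq ht
        (mul_neg_of_neg_of_pos (mul_neg_of_pos_of_neg h.1 (by linarith)) hc0)
    · exact key 1 (by omega) (by simp [h.1]) (mul_ne_zero
        (mul_ne_zero (by linarith) (sub_ne_zero.mpr h.2)) hc1)
    · have hp : 0 < η 2 * (η 2 - 1) := mul_pos (by linarith) (by linarith)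
      have hz : ∀ i < 2, η i * (η i - 1) * c i = 0 := by
        intro i hi
        interval_cases i <;> simp [h.1, h.2]
      filter_upwards [key 2 hN hz (mul_ne_zero hp.ne' hc2)] with t ht
      rw [ht, Real.sign_mul_of_pos_left hp]
    · filter_upwards [key0 h.ne (by linarith)] with t ht
      exact Real.pos_of_sign_eq ht (mul_pos (mul_pos_of_neg_of_neg h (by linarith)) hc0)
  obtain ⟨u, hu, hsub⟩ := mem_nhdsGT_iff_exists_Ioo_subset.mp main
  have hu : t0 < u := hu
  refine ⟨min (u - t0) (δ / 2), lt_min (by linarith) (by linarith),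
    (min_le_right _ _).trans_lt (by linarith), fun t ht => hsub ⟨ht.1, ?_⟩⟩
  linarith [ht.2, min_le_left (u - t0) (δ / 2)]
end

section
/- (Finiteness of the age of the universe.) Let k ∈ ℝ, 0 ≤ a⊙ < a₀, and let ρ be a real-valued function continuous on (a⊙, a₀] satisfying the reality condition ρ(a)·a²/3 − k > 0 for all a ∈ (a⊙, a₀]. Suppose there exist constants α < 1, c > 0 and a_ε ∈ (a⊙, a₀) such that ρ(a) ≥ 3k/a² + c²·a^{2α−2} for all a ∈ (a⊙, a_ε), and ρ(a) ≥ ρ(a_ε) for all a ∈ [a_ε, a₀]. Then the function a ↦ 1/√(ρ(a)·a²/3 − k) is integrable on the interval (a⊙, a₀); i.e. the age of the universe τ = ∫_{a⊙}^{a₀} da/√(ρ(a)a²/3 − k) is real and finite. -/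
open MeasureTheory

/-- Finiteness of the age of the universe: under the reality condition and the
stated convergence bounds on the density `ρ(a)`, the integrand
`1/√(ρ(a)a²/3 − k)` is integrable on `(a⊙, a₀)`, so the age
`τ = ∫_{a⊙}^{a₀} da/√(ρ(a)a²/3 − k)` is real and finite. -/
theorem age_of_universe_real_and_finite
    (k aS a0 : ℝ) (ρ : ℝ → ℝ)
    (haS : 0 ≤ aS) (ha0 : aS < a0)
    (hcont : ContinuousOn ρ (Set.Ioc aS a0))
    (hreal : ∀ s ∈ Set.Ioc aS a0, 0 < ρ s * s ^ 2 / 3 - k)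
    (α cc aε : ℝ)
    (hα : α < 1) (hcc : 0 < cc) (haε : aε ∈ Set.Ioo aS a0)
    (hlow : ∀ s ∈ Set.Ioo aS aε, 3 * k / s ^ 2 + cc ^ 2 * s ^ (2 * α - 2) ≤ ρ s)
    (hmono : ∀ s ∈ Set.Icc aε a0, ρ aε ≤ ρ s) :
    IntegrableOn (fun s => 1 / Real.sqrt (ρ s * s ^ 2 / 3 - k))
      (Set.Ioo aS a0) volume := by
  have hcontInt : ContinuousOn (fun s => 1 / Real.sqrt (ρ s * s ^ 2 / 3 - k))
      (Set.Ioc aS a0) := by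
    refine continuousOn_const.div (Real.continuous_sqrt.comp_continuousOn ?_) ?_
    · exact ((hcont.mul (continuousOn_id.pow 2)).div_const 3).sub continuousOn_const
    · exact fun s hs => (Real.sqrt_pos.2 (hreal s hs)).ne'
  have hlate : IntegrableOn (fun s => 1 / Real.sqrt (ρ s * s ^ 2 / 3 - k))
      (Set.Icc aε a0) volume :=
    (hcontInt.mono fun s hs => ⟨haε.1.trans_le hs.1, hs.2⟩).integrableOn_Icc
  have hpow : IntegrableOn (fun s : ℝ => Real.sqrt 3 / cc * s ^ (-α)) (Set.Ioo aS aε) volume := by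
    have h := (intervalIntegral.integrableOn_Ioo_rpow_iff (s := -α)
      (haS.trans_lt haε.1)).2 (by linarith)
    exact (h.mono_set (Set.Ioo_subset_Ioo_left haS)).const_mul _
  have hearly : IntegrableOn (fun s => 1 / Real.sqrt (ρ s * s ^ 2 / 3 - k))
      (Set.Ioo aS aε) volume := by
    refine Integrable.mono' hpow ((hcontInt.mono fun s hs =>
      ⟨hs.1, hs.2.le.trans haε.2.le⟩).aestronglyMeasurable measurableSet_Ioo) ?_
    refine (ae_restrict_iff' measurableSet_Ioo).2 (Filter.Eventually.of_forall fun s hs => ?_)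
    have hs0 : 0 < s := haS.trans_lt hs.1
    have hsα : 0 < s ^ α := Real.rpow_pos_of_pos hs0 α
    have hsq : s ^ (2 * α - 2) * s ^ 2 = (s ^ α) ^ 2 := by
      rw [← Real.rpow_natCast s 2, ← Real.rpow_add hs0, ← Real.rpow_mul_natCast hs0.le]
      congr 1
      push_cast
      ring
    have hbound : (cc * s ^ α) ^ 2 / 3 ≤ ρ s * s ^ 2 / 3 - k := by
      have h := mul_le_mul_of_nonneg_right (hlow s hs) (sq_nonneg s)
      rw [add_mul, div_mul_cancel₀ _ (pow_ne_zero 2 hs0.ne'), mul_assoc, hsq] at h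
      linarith
    have hsqrt : cc * s ^ α / Real.sqrt 3 ≤ Real.sqrt (ρ s * s ^ 2 / 3 - k) := by
      refine Real.le_sqrt_of_sq_le ?_
      rwa [div_pow, Real.sq_sqrt (by norm_num)]
    rw [Real.norm_of_nonneg (by positivity)]
    calc 1 / Real.sqrt (ρ s * s ^ 2 / 3 - k)
        ≤ 1 / (cc * s ^ α / Real.sqrt 3) := one_div_le_one_div_of_le (by positivity) hsqrt
      _ = Real.sqrt 3 / cc * s ^ (-α) := by
        rw [Real.rpow_neg hs0.le]
        field_simp
  refine (hearly.union hlate).mono_set fun s hs => ?_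
  rcases lt_or_ge s aε with h | h
  · exact Or.inl ⟨hs.1, h⟩
  · exact Or.inr ⟨h, hs.2.le⟩
end

section
/- (Finiteness of the remaining lifetime, case a_end = ∞.) Let k ∈ ℝ, a₀ > 0, and let ρ be a real-valued function continuous on [a₀, ∞) satisfying the reality condition ρ(a)·a²/3 − k > 0 for all a ≥ a₀. Suppose there exist constants β > 1, c > 0 and a_ε > a₀ such that ρ(a) ≥ 3k/a² + c²·a^{2β−2} for all a ≥ a_ε, and ρ(a) ≥ ρ(a_ε) for all a ∈ [a₀, a_ε]. Then the function a ↦ 1/√(ρ(a)·a²/3 − k) is integrable on (a₀, ∞); i.e. the remaining lifetime of the universe T = ∫_{a₀}^{∞} da/√(ρ(a)a²/3 − k) is real and finite (a big rip occurs at finite time). -/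
open MeasureTheory

/-- Finiteness of the remaining lifetime of the universe (case `a_end = ∞`):
under the reality condition and the stated convergence bounds on the density
`ρ(a)`, the integrand `1/√(ρ(a)a²/3 − k)` is integrable on `(a₀, ∞)`, so the
remaining lifetime `T = ∫_{a₀}^{∞} da/√(ρ(a)a²/3 − k)` is real and finite
(a big rip occurs at finite time). -/
theorem remaining_lifetime_real_and_finite
    (k a0 : ℝ) (ρ : ℝ → ℝ)
    (ha0 : 0 < a0)
    (hcont : ContinuousOn ρ (Set.Ici a0))
    (hreal : ∀ s, a0 ≤ s → 0 < ρ s * s ^ 2 / 3 - k)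
    (β cc aε : ℝ)
    (hβ : 1 < β) (hcc : 0 < cc) (haε : a0 < aε)
    (hlow : ∀ s, aε ≤ s → 3 * k / s ^ 2 + cc ^ 2 * s ^ (2 * β - 2) ≤ ρ s)
    (hmono : ∀ s ∈ Set.Icc a0 aε, ρ aε ≤ ρ s) :
    IntegrableOn (fun s => 1 / Real.sqrt (ρ s * s ^ 2 / 3 - k))
      (Set.Ioi a0) volume := by
  have hfcont : ContinuousOn (fun s => 1 / Real.sqrt (ρ s * s ^ 2 / 3 - k)) (Set.Ici a0) := by
    refine continuousOn_const.div (Real.continuous_sqrt.comp_continuousOn ?_) ?_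
    · exact ((hcont.mul (continuousOn_id.pow 2)).div_const 3).sub continuousOn_const
    · exact fun s hs => (Real.sqrt_pos.2 (hreal s hs)).ne'
  have haε_pos : 0 < aε := ha0.trans haε
  rw [← Set.Ioc_union_Ioi_eq_Ioi haε.le]
  refine IntegrableOn.union ?_ ?_
  · exact ((hfcont.mono Set.Icc_subset_Ici_self).integrableOn_Icc).mono_set Set.Ioc_subset_Icc_self
  · have hmajorant : IntegrableOn (fun s : ℝ => Real.sqrt 3 / cc * s ^ (-β)) (Set.Ioi aε) volume :=
      (integrableOn_Ioi_rpow_of_lt (by linarith) haε_pos).const_mul _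
    refine hmajorant.mono' ?_ ?_
    · refine (hfcont.mono fun s hs => ?_).aestronglyMeasurable measurableSet_Ioi
      exact (haε.trans hs).le
    · filter_upwards [ae_restrict_mem measurableSet_Ioi] with s hs
      have hs_le : aε ≤ s := le_of_lt hs
      have hs_pos : 0 < s := haε_pos.trans hs
      have hpow : 0 < s ^ β := Real.rpow_pos_of_pos hs_pos β
      have hsq : s ^ (2 * β - 2) * s ^ 2 = (s ^ β) ^ 2 := by
        rw [← Real.rpow_natCast s 2, ← Real.rpow_natCast (s ^ β) 2, ← Real.rpow_add hs_pos,
          ← Real.rpow_mul hs_pos.le]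
        congr 1
        push_cast
        ring
      have hbound : (cc / Real.sqrt 3 * s ^ β) ^ 2 ≤ ρ s * s ^ 2 / 3 - k := by
        have h := mul_le_mul_of_nonneg_right (hlow s hs_le) (sq_nonneg s)
        rw [add_mul, div_mul_cancel₀ _ (pow_pos hs_pos 2).ne', mul_assoc, hsq] at h
        rw [mul_pow, div_pow, Real.sq_sqrt (by norm_num)]
        linarith
      rw [Real.norm_of_nonneg (by positivity)]
      calc 1 / Real.sqrt (ρ s * s ^ 2 / 3 - k)
          ≤ 1 / (cc / Real.sqrt 3 * s ^ β) :=
            one_div_le_one_div_of_le (by positivity) (Real.le_sqrt_of_sq_le hbound)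
        _ = Real.sqrt 3 / cc * s ^ (-β) := by
            rw [Real.rpow_neg hs_pos.le]
            field_simp
end

section
/- (First inconsistency: the isotropic TOV equation forces decreasing pressure at a pressure zero.) Let ρ : ℝ → ℝ be continuous with ρ(s) > 0 for all s ∈ [0, r₀], where r₀ > 0, and set m(r) = 4π ∫₀^r ρ(s)·s² ds. Assume there is no horizon at r₀, i.e. 2m(r₀) < r₀. If p : ℝ → ℝ is differentiable at r₀, p(r₀) = 0, and p satisfies the isotropic TOV equation at r₀, namely p′(r₀) = −(ρ(r₀) + p(r₀))·(m(r₀) + 4π·p(r₀)·r₀³)/(r₀²·(1 − 2m(r₀)/r₀)), then p′(r₀) < 0. In particular, a static spherically symmetric perfect fluid with positive density cannot have its pressure increasing through a zero, so a gravastar (whose pressure rises through zero from negative central pressure) cannot be a perfect fluid at that point. -/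
/-- First inconsistency: at a radius `r₀` where the pressure vanishes, the isotropic
TOV equation forces the pressure to be strictly decreasing — so a gravastar (whose
pressure rises through zero) cannot be a perfect fluid there. -/
theorem isotropic_TOV_forces_decreasing_pressure_at_zero
    (r₀ : ℝ) (hr₀ : 0 < r₀) (ρ p m : ℝ → ℝ)
    (hρcont : ContinuousOn ρ (Set.Icc 0 r₀))
    (hρpos : ∀ s ∈ Set.Icc 0 r₀, 0 < ρ s)
    (hm : ∀ r : ℝ, m r = 4 * Real.pi * ∫ s in (0 : ℝ)..r, ρ s * s ^ 2)
    (hnohorizon : 2 * m r₀ < r₀)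
    (hpdiff : DifferentiableAt ℝ p r₀)
    (hp0 : p r₀ = 0)
    (hTOV : deriv p r₀ =
      -((ρ r₀ + p r₀) * (m r₀ + 4 * Real.pi * p r₀ * r₀ ^ 3)) /
        (r₀ ^ 2 * (1 - 2 * m r₀ / r₀))) :
    deriv p r₀ < 0 := by
  have hint : 0 < ∫ s in (0 : ℝ)..r₀, ρ s * s ^ 2 := by
    refine intervalIntegral.intervalIntegral_pos_of_pos_on ?_ ?_ hr₀
    · refine ContinuousOn.intervalIntegrable ?_
      rw [Set.uIcc_of_le hr₀.le]
      exact hρcont.mul (continuous_pow 2).continuousOn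
    · intro s hs
      exact mul_pos (hρpos s (Set.Ioo_subset_Icc_self hs)) (pow_pos hs.1 2)
  have hmpos : 0 < m r₀ := by
    rw [hm]
    positivity
  have hρ : 0 < ρ r₀ := hρpos r₀ (Set.right_mem_Icc.mpr hr₀.le)
  have hmetric : 0 < 1 - 2 * m r₀ / r₀ := by
    rw [sub_pos, div_lt_one hr₀]
    exact hnohorizon
  rw [hTOV, hp0, neg_div, neg_lt_zero]
  simp only [add_zero, mul_zero, zero_mul]
  positivity
end

section
/- (Compactness above 4/5 forces violation of the dominant energy condition.) Let r > 0, ρ > 0, m > 0 be real numbers with 4/5 < 2m/r < 1, and let p ≥ 0 and p′ ≥ 0 be real numbers. Define Δ = (r/2)·[ p′/ρ + (1 + p/ρ)·(m + 4π·p·r³)/(r²·(1 − 2m/r)) ]. Then Δ > 1. Consequently, since the dominant energy condition (ρ ≥ 0 and |p_t| ≤ ρ together with p_r = p ≥ 0) forces Δ = (p_t − p_r)/ρ ≤ 1, any gravastar whose local compactness 2m/r exceeds 4/5 somewhere in its crust must violate the dominant energy condition there. -/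
/-- Compactness above `4/5` forces violation of the dominant energy condition:
under the crust conditions (`p ≥ 0`, `p′ ≥ 0`) with local compactness
`4/5 < 2m/r < 1`, the dimensionless anisotropy satisfies `Δ > 1`; consequently
any tangential pressure `p_t` realizing this anisotropy, `Δ = (p_t − p)/ρ`,
must satisfy `|p_t| > ρ`, violating the DEC. -/
theorem high_compactness_violates_DEC
    (r ρ m p p' Δ : ℝ)
    (hr : 0 < r) (hρ : 0 < ρ) (hm : 0 < m)
    (hlow : 4 / 5 < 2 * m / r) (hcompact : 2 * m / r < 1)
    (hp : 0 ≤ p) (hp' : 0 ≤ p')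
    (hΔ : Δ = (r / 2) *
      (p' / ρ + (1 + p / ρ) * (m + 4 * Real.pi * p * r ^ 3) / (r ^ 2 * (1 - 2 * m / r)))) :
    1 < Δ ∧ ∀ pt : ℝ, (pt - p) / ρ = Δ → ρ < |pt| := by
  have hΔ_gt : 1 < Δ := by
    have hden : 0 < r ^ 2 * (1 - 2 * m / r) := mul_pos (by positivity) (by linarith)
    have hmr : 4 / 5 * r < 2 * m := (lt_div_iff₀ hr).mp hlow
    have hnum : m ≤ (1 + p / ρ) * (m + 4 * Real.pi * p * r ^ 3) := by
      have h₁ : 0 ≤ p / ρ := by positivity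
      have h₂ : 0 ≤ 4 * Real.pi * p * r ^ 3 := by positivity
      nlinarith [mul_nonneg h₁ hm.le, mul_nonneg h₁ h₂]
    have hfrac : 2 / r < (1 + p / ρ) * (m + 4 * Real.pi * p * r ^ 3) /
        (r ^ 2 * (1 - 2 * m / r)) := by
      rw [lt_div_iff₀ hden]
      have : 2 / r * (r ^ 2 * (1 - 2 * m / r)) = 2 * r - 4 * m := by
        field_simp
        ring
      linarith
    have hq : 0 ≤ p' / ρ := by positivity
    calc (1 : ℝ) = r / 2 * (2 / r) := by field_simp
      _ < r / 2 * (p' / ρ + (1 + p / ρ) * (m + 4 * Real.pi * p * r ^ 3) /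
          (r ^ 2 * (1 - 2 * m / r))) :=
        mul_lt_mul_of_pos_left (by linarith) (by positivity)
      _ = Δ := hΔ.symm
  refine ⟨hΔ_gt, fun pt hpt => ?_⟩
  rw [← hpt, one_lt_div hρ] at hΔ_gt
  exact lt_of_lt_of_le (by linarith) (le_abs_self pt)
end
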